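/- arXiv:2501.16517 — 2 statements merged into one kernel-verified Lean document; each statement's English description precedes it below -/
import Mathlib

section
/- For any full-rank lattice L(B) ⊆ ℝ^n generated by invertible B, any ε > 0, s ≥ η_ε(L(B)), and any mean μ ∈ ℝ^n, the distribution of a Gaussian sample from N(μ, (s²/2π)·I_n) reduced modulo the fundamental parallelepiped P(B) has total variation distance at most ε/2 from the uniform distribution on P(B). -/
open MeasureTheory ProbabilityTheory
open scoped BigOperators Real

noncomputable section

/-- The lattice generated by the columns of `B`. -/
def latticeSet {n : ℕ} (B : Matrix (Fin n) (Fin n) ℝ) : Set (Fin n → ℝ) :=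
  {x | ∃ z : Fin n → ℤ, x = B.mulVec fun i => (z i : ℝ)}

/-- The dual lattice. -/
def dualLattice {n : ℕ} (B : Matrix (Fin n) (Fin n) ℝ) : Set (Fin n → ℝ) :=
  {x | ∀ v ∈ latticeSet B, ∃ k : ℤ, (∑ i, x i * v i) = (k : ℝ)}

/-- Gaussian mass `ρ_{s,0}(S)` of a set `S ⊆ ℝ^n`. -/
def rhoOnSet {n : ℕ} (s : ℝ) (S : Set (Fin n → ℝ)) : ℝ :=
  ∑' x : S, Real.exp (-π * (∑ i, (x : Fin n → ℝ) i ^ 2) / s ^ 2)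

/-- The smoothing parameter `η_ε(L(B))`. -/
def smoothingParam {n : ℕ} (B : Matrix (Fin n) (Fin n) ℝ) (ε : ℝ) : ℝ :=
  sInf {s : ℝ | 0 < s ∧ rhoOnSet (1 / s) (dualLattice B \ {0}) ≤ ε}

/-- Reduction of `x ∈ ℝ^n` modulo the fundamental parallelepiped `P(B) = B·[0,1)^n`. -/
def reduceModP {n : ℕ} (B : Matrix (Fin n) (Fin n) ℝ) (x : Fin n → ℝ) : Fin n → ℝ :=
  B.mulVec fun i => Int.fract ((B⁻¹).mulVec x i)

/-- The uniform distribution on the fundamental parallelepiped `P(B)`. -/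
def uniformP {n : ℕ} (B : Matrix (Fin n) (Fin n) ℝ) : Measure (Fin n → ℝ) :=
  (Measure.pi fun _ : Fin n => volume.restrict (Set.Ico (0 : ℝ) 1)).map B.mulVec


lemma aux_poly {n : ℕ} (ν V : Measure (UnitAddTorus (Fin n))) [IsProbabilityMeasure ν]
    [IsProbabilityMeasure V] (ε : ℝ)
    (hV : ∀ w : Fin n → ℤ, ∫ t, UnitAddTorus.mFourier w t ∂V = if w = 0 then 1 else 0)
    (hν : ∀ F : Finset (Fin n → ℤ), 0 ∉ F → ∑ w ∈ F, ‖∫ t, UnitAddTorus.mFourier w t ∂ν‖ ≤ ε)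
    (p : C(UnitAddTorus (Fin n), ℂ)) (hp : p ∈ Submodule.span ℂ (Set.range UnitAddTorus.mFourier)) :
    ‖∫ t, p t ∂ν - ∫ t, p t ∂V‖ ≤ ε * ∫ t, ‖p t‖ ∂V := by
  have hint : ∀ (m : Measure (UnitAddTorus (Fin n))) [IsProbabilityMeasure m]
      (f : C(UnitAddTorus (Fin n), ℂ)), Integrable (fun t => f t) m := by
    intro m _ f
    exact f.continuous.integrable_of_hasCompactSupport (HasCompactSupport.of_compactSpace _)
  obtain ⟨c, hc⟩ := (Finsupp.mem_span_range_iff_exists_finsupp).1 hp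
  have hpt : ∀ t, p t = ∑ w ∈ c.support, c w * UnitAddTorus.mFourier w t := by
    intro t; rw [← hc]; simp [Finsupp.sum]
  have hI : ∀ (m : Measure (UnitAddTorus (Fin n))) [IsProbabilityMeasure m],
      ∫ t, p t ∂m = ∑ w ∈ c.support, c w * ∫ t, UnitAddTorus.mFourier w t ∂m := by
    intro m _
    simp_rw [hpt]
    rw [integral_finsetSum _ (fun w _ => (hint m _).const_mul _)]
    simp_rw [integral_const_mul]
  have hcw : ∀ w, c w = ∫ t, UnitAddTorus.mFourier (-w) t * p t ∂V := by
    intro w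
    have : ∀ t, UnitAddTorus.mFourier (-w) t * p t =
        ∑ v ∈ c.support, c v * UnitAddTorus.mFourier (-w + v) t := by
      intro t
      rw [hpt, Finset.mul_sum]
      refine Finset.sum_congr rfl fun v _ => ?_
      rw [UnitAddTorus.mFourier_add]; ring
    simp_rw [this]
    rw [integral_finsetSum _ (fun w _ => (hint V _).const_mul _)]
    simp_rw [integral_const_mul, hV, neg_add_eq_zero]
    simp
  have hcb : ∀ w, ‖c w‖ ≤ ∫ t, ‖p t‖ ∂V := by
    intro w
    rw [hcw]
    refine (norm_integral_le_integral_norm _).trans (integral_mono_of_nonneg ?_ (hint V p).norm ?_)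
    · exact Filter.Eventually.of_forall fun t => norm_nonneg _
    · refine Filter.Eventually.of_forall fun t => ?_
      have := (UnitAddTorus.mFourier (-w)).norm_coe_le_norm t
      rw [UnitAddTorus.mFourier_norm] at this
      simp only [norm_mul]
      exact mul_le_of_le_one_left (norm_nonneg _) this
  have h0 : ∫ t, UnitAddTorus.mFourier (0 : Fin n → ℤ) t ∂ν = 1 := by
    simp [UnitAddTorus.mFourier_zero]
  have key : ∫ t, p t ∂ν - ∫ t, p t ∂V =
      ∑ w ∈ c.support.erase 0, c w * ∫ t, UnitAddTorus.mFourier w t ∂ν := by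
    rw [hI ν, hI V, ← Finset.sum_sub_distrib]
    rw [← Finset.sum_erase c.support (a := 0)
      (f := fun x => c x * ∫ t, UnitAddTorus.mFourier x t ∂ν - c x * ∫ t, UnitAddTorus.mFourier x t ∂V)]
    · refine Finset.sum_congr rfl fun w hw => ?_
      rw [hV, if_neg (Finset.ne_of_mem_erase hw)]; simp
    · rw [h0, hV]; simp
  rw [key]
  calc _ ≤ ∑ w ∈ c.support.erase 0, (∫ t, ‖p t‖ ∂V) * ‖∫ t, UnitAddTorus.mFourier w t ∂ν‖ := by
        refine norm_sum_le_of_le _ fun w _ => ?_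
        rw [norm_mul]
        exact mul_le_mul_of_nonneg_right (hcb w) (norm_nonneg _)
    _ = (∫ t, ‖p t‖ ∂V) * ∑ w ∈ c.support.erase 0, ‖∫ t, UnitAddTorus.mFourier w t ∂ν‖ := by
        rw [Finset.mul_sum]
    _ ≤ (∫ t, ‖p t‖ ∂V) * ε := by
        refine mul_le_mul_of_nonneg_left (hν _ (by simp)) (integral_nonneg fun _ => norm_nonneg _)
    _ = _ := mul_comm _ _

lemma aux_set {n : ℕ} (ν V : Measure (UnitAddTorus (Fin n))) [IsProbabilityMeasure ν]
    [IsProbabilityMeasure V] (ε : ℝ) (hε : 0 < ε)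
    (hV : ∀ w : Fin n → ℤ, ∫ t, UnitAddTorus.mFourier w t ∂V = if w = 0 then 1 else 0)
    (hν : ∀ F : Finset (Fin n → ℤ), 0 ∉ F → ∑ w ∈ F, ‖∫ t, UnitAddTorus.mFourier w t ∂ν‖ ≤ ε)
    (A : Set (UnitAddTorus (Fin n))) (hA : MeasurableSet A) :
    |ν.real A - V.real A| ≤ ε * V.real A := by
  have hint : ∀ (m : Measure (UnitAddTorus (Fin n))) [IsFiniteMeasure m]
      (f : C(UnitAddTorus (Fin n), ℂ)), Integrable (fun t => f t) m := by
    intro m _ f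
    exact f.continuous.integrable_of_hasCompactSupport (HasCompactSupport.of_compactSpace _)
  have main : ∀ δ : ℝ, 0 < δ → |ν.real A - V.real A| ≤ ε * (V.real A + 3 * δ) + 6 * δ := by
    intro δ hδ
    set g : UnitAddTorus (Fin n) → ℂ := A.indicator (fun _ => 1) with hg
    have hgi : ∀ (m : Measure (UnitAddTorus (Fin n))) [IsFiniteMeasure m], Integrable g m :=
      fun m _ => (integrable_const 1).indicator hA
    obtain ⟨f, hf, hfi⟩ := (hgi (ν + V)).exists_boundedContinuous_integral_sub_le hδ
    have hd : f.toContinuousMap ∈ closure (Submodule.span ℂ (Set.range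
        (UnitAddTorus.mFourier (d := Fin n))) : Set C(UnitAddTorus (Fin n), ℂ)) := by
      have := UnitAddTorus.span_mFourier_closure_eq_top (d := Fin n)
      rw [← Submodule.topologicalClosure_coe, this]; trivial
    obtain ⟨p, hp, hfp⟩ := Metric.mem_closure_iff.1 hd δ hδ
    have hpf : ∀ t, ‖f t - p t‖ ≤ δ := by
      intro t
      have := (f.toContinuousMap - p).norm_coe_le_norm t
      rw [dist_eq_norm] at hfp
      exact this.trans hfp.le
    have hgp : ∀ (m : Measure (UnitAddTorus (Fin n))) [IsProbabilityMeasure m],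
        m ≤ ν + V → ∫ t, ‖g t - p t‖ ∂m ≤ 2 * δ := by
      intro m _ hm
      have hfm : Integrable (fun t => f t) m := hint m f.toContinuousMap
      have h1 : ∫ t, ‖g t - f t‖ ∂m ≤ δ := by
        refine le_trans ?_ hf
        exact integral_mono_measure hm (Filter.Eventually.of_forall fun t => norm_nonneg _)
          ((hgi _).sub hfi).norm
      have h2 : ∫ t, ‖f t - p t‖ ∂m ≤ δ := by
        calc _ ≤ ∫ t, δ ∂m := integral_mono (hfm.sub (hint m p)).norm (integrable_const _) hpf
          _ = δ := by simp
      calc _ ≤ ∫ t, (‖g t - f t‖ + ‖f t - p t‖) ∂m := by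
            refine integral_mono ((hgi m).sub (hint m p)).norm
              (((hgi m).sub hfm).norm.add (hfm.sub (hint m p)).norm) fun t => ?_
            exact norm_sub_le_norm_sub_add_norm_sub _ _ _
        _ = _ := integral_add ((hgi m).sub hfm).norm (hfm.sub (hint m p)).norm
        _ ≤ _ := by linarith
    have hgI : ∀ (m : Measure (UnitAddTorus (Fin n))) [IsProbabilityMeasure m],
        ∫ t, g t ∂m = (m.real A : ℂ) := by
      intro m _
      rw [hg, integral_indicator_const _ hA]; simp
    have hgN : ∫ t, ‖g t‖ ∂V = V.real A := by
      have : (fun t => ‖g t‖) = A.indicator (fun _ => (1:ℝ)) := by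
        ext t; by_cases h : t ∈ A <;> simp [hg, h]
      rw [this, integral_indicator_const _ hA]; simp
    have hd : ∀ (m : Measure (UnitAddTorus (Fin n))) [IsProbabilityMeasure m],
        m ≤ ν + V → ‖(m.real A : ℂ) - ∫ t, p t ∂m‖ ≤ 2 * δ := by
      intro m _ hm
      rw [← hgI, ← integral_sub (hgi m) (hint m p)]
      exact (norm_integral_le_integral_norm _).trans (hgp m hm)
    have hνle : ν ≤ ν + V := Measure.le_add_right le_rfl
    have hVle : V ≤ ν + V := Measure.le_add_left le_rfl
    have hpn : ∫ t, ‖p t‖ ∂V ≤ V.real A + 2 * δ := by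
      calc _ ≤ ∫ t, (‖g t‖ + ‖g t - p t‖) ∂V := by
            refine integral_mono (hint V p).norm
              ((hgi V).norm.add ((hgi V).sub (hint V p)).norm) fun t => ?_
            have := norm_sub_norm_le (p t) (g t)
            rw [norm_sub_rev] at this
            simp only
            linarith
        _ = _ := integral_add (hgi V).norm ((hgi V).sub (hint V p)).norm
        _ ≤ _ := by rw [hgN]; linarith [hgp V hVle]
    have h3 := aux_poly ν V ε hV hν p hp
    have h4 : |ν.real A - V.real A| = ‖(ν.real A : ℂ) - V.real A‖ := by
      rw [← Complex.ofReal_sub, Complex.norm_real, Real.norm_eq_abs]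
    have h5 : (ν.real A : ℂ) - V.real A = ((ν.real A : ℂ) - ∫ t, p t ∂ν) +
      (∫ t, p t ∂ν - ∫ t, p t ∂V) - ((V.real A : ℂ) - ∫ t, p t ∂V) := by ring
    rw [h4, h5]
    have h6 : ε * ∫ t, ‖p t‖ ∂V ≤ ε * (V.real A + 3 * δ) :=
      mul_le_mul_of_nonneg_left (by linarith) hε.le
    refine (norm_sub_le _ _).trans ?_
    refine (add_le_add (norm_add_le _ _) le_rfl).trans ?_
    linarith [hd ν hνle, hd V hVle]
  refine le_of_forall_pos_le_add fun η hη => ?_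
  have hden : 0 < 3 * ε + 6 := by linarith
  refine (main (η / (3 * ε + 6)) (by positivity)).trans (le_of_eq ?_)
  field_simp; ring

lemma aux_tv {n : ℕ} (ν V : Measure (UnitAddTorus (Fin n))) [IsProbabilityMeasure ν]
    [IsProbabilityMeasure V] (ε : ℝ) (hε : 0 < ε)
    (hV : ∀ w : Fin n → ℤ, ∫ t, UnitAddTorus.mFourier w t ∂V = if w = 0 then 1 else 0)
    (hν : ∀ F : Finset (Fin n → ℤ), 0 ∉ F → ∑ w ∈ F, ‖∫ t, UnitAddTorus.mFourier w t ∂ν‖ ≤ ε)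
    (A : Set (UnitAddTorus (Fin n))) (hA : MeasurableSet A) :
    |ν.real A - V.real A| ≤ ε / 2 := by
  have h1 := aux_set ν V ε hε hV hν A hA
  have h2 := aux_set ν V ε hε hV hν Aᶜ hA.compl
  rw [probReal_compl_eq_one_sub hA, probReal_compl_eq_one_sub hA] at h2
  have : |1 - ν.real A - (1 - V.real A)| = |ν.real A - V.real A| := by
    rw [← abs_neg]; congr 1; ring
  rw [this] at h2
  linarith

lemma aux_int_fourier (k : ℤ) :
    ∫ x in Set.Ico (0:ℝ) 1, (fourier k (x : UnitAddCircle) : ℂ) = if k = 0 then 1 else 0 := by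
  rw [restrict_Ico_eq_restrict_Ioc, ← intervalIntegral.integral_of_le zero_le_one]
  simp only [fourier_coe_apply]
  split_ifs with h
  · simp [h]
  · have hc : (2 * π * Complex.I * k : ℂ) ≠ 0 := by
      simp [Real.pi_ne_zero, Complex.I_ne_zero, h]
    have := integral_exp_mul_complex (a := 0) (b := 1) hc
    simp only [Complex.ofReal_one, div_one]
    rw [this]
    have h1 : Complex.exp (2 * π * Complex.I * k * (1:ℝ)) = 1 := by
      rw [Complex.exp_eq_one_iff]; exact ⟨k, by push_cast; ring⟩
    rw [h1]; simp

/-- coordinatewise quotient -/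
def toTorus {n : ℕ} (x : Fin n → ℝ) : UnitAddTorus (Fin n) := fun i => (x i : UnitAddCircle)

/-- section -/
def ofTorus {n : ℕ} (t : UnitAddTorus (Fin n)) : Fin n → ℝ :=
  fun i => (AddCircle.equivIco 1 0 (t i) : ℝ)

lemma measurable_toTorus {n : ℕ} : Measurable (toTorus (n := n)) :=
  (continuous_pi fun i => (AddCircle.continuous_mk' 1).comp (continuous_apply i)).measurable

lemma measurable_ofTorus {n : ℕ} : Measurable (ofTorus (n := n)) := by
  refine measurable_pi_lambda _ fun i => ?_
  exact measurable_subtype_coe.comp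
    ((AddCircle.measurableEquivIco 1 0).measurable.comp (measurable_pi_apply i))

lemma ofTorus_toTorus {n : ℕ} (x : Fin n → ℝ) : ofTorus (toTorus x) = fun i => Int.fract (x i) := by
  ext i
  have := AddCircle.coe_equivIco_mk_apply (1:ℝ) (x i)
  rw [div_one, mul_one] at this
  exact this

lemma aux_V {n : ℕ} (w : Fin n → ℤ) :
    ∫ t, UnitAddTorus.mFourier w t ∂((Measure.pi fun _ : Fin n =>
      (volume : Measure ℝ).restrict (Set.Ico (0 : ℝ) 1)).map toTorus) = if w = 0 then 1 else 0 := by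
  rw [integral_map measurable_toTorus.aemeasurable
    (UnitAddTorus.mFourier w).continuous.aestronglyMeasurable]
  simp only [UnitAddTorus.mFourier, ContinuousMap.coe_mk, toTorus]
  rw [integral_fintype_prod_eq_prod (fun i (x : ℝ) => (fourier (w i) (x : UnitAddCircle) : ℂ))]
  simp_rw [aux_int_fourier]
  split_ifs with h
  · simp [h]
  · obtain ⟨i, hi⟩ := Function.ne_iff.1 h
    exact Finset.prod_eq_zero (Finset.mem_univ i) (if_neg hi)

lemma aux_nu {n : ℕ} (C : Matrix (Fin n) (Fin n) ℝ) (s : ℝ) (μ : Fin n → ℝ) (w : Fin n → ℤ) :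
    ‖∫ t, UnitAddTorus.mFourier w t ∂((Measure.pi fun i : Fin n =>
        gaussianReal (μ i) (Real.toNNReal (s ^ 2 / (2 * π)))).map (fun x => toTorus (C.mulVec x)))‖
      = Real.exp (-π * s ^ 2 * ∑ j, (C.transpose.mulVec (fun i => (w i : ℝ)) j) ^ 2) := by
  have hm : Measurable (fun x => toTorus (C.mulVec x)) :=
    measurable_toTorus.comp (Continuous.measurable (by fun_prop))
  rw [integral_map hm.aemeasurable
    (UnitAddTorus.mFourier w).continuous.aestronglyMeasurable]
  have h1 : ∀ x : Fin n → ℝ, UnitAddTorus.mFourier w (toTorus (C.mulVec x)) =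
      ∏ j, Complex.exp ((2 * π * (C.transpose.mulVec (fun i => (w i : ℝ)) j) : ℝ) * (x j) * Complex.I) := by
    intro x
    simp only [UnitAddTorus.mFourier, ContinuousMap.coe_mk, toTorus, fourier_coe_apply]
    rw [← Complex.exp_sum, ← Complex.exp_sum]
    congr 1
    simp only [Matrix.mulVec, dotProduct, Matrix.transpose_apply]
    push_cast
    simp only [Finset.mul_sum, Finset.sum_mul, Finset.sum_div]
    rw [Finset.sum_comm]
    refine Finset.sum_congr rfl fun j _ => Finset.sum_congr rfl fun i _ => ?_
    simp; ring
  simp_rw [h1]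
  rw [integral_fintype_prod_eq_prod (fun j (y : ℝ) => Complex.exp
    ((2 * π * (C.transpose.mulVec (fun i => (w i : ℝ)) j) : ℝ) * (y) * Complex.I))]
  rw [norm_prod, Finset.mul_sum, Real.exp_sum]
  refine Finset.prod_congr rfl fun j _ => ?_
  rw [← charFun_apply_real, charFun_gaussianReal, Complex.norm_exp]
  congr 1
  rw [Real.coe_toNNReal _ (by positivity)]
  generalize C.transpose.mulVec (fun i => (w i : ℝ)) j = y
  have : ((2 * π * y : ℝ) * (μ j) * Complex.I - (s ^ 2 / (2 * π) : ℝ) * (2 * π * y : ℝ) ^ 2 / 2 : ℂ) =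
    ((- (s ^ 2 / (2 * π) * (2 * π * y) ^ 2 / 2) : ℝ) : ℂ) + ((2 * π * y * μ j : ℝ) : ℂ) * Complex.I := by
    push_cast; ring
  rw [this]
  simp only [Complex.add_re, Complex.ofReal_re, Complex.re_ofReal_mul, Complex.I_re]
  have := Real.pi_pos
  field_simp
  simp
  ring

lemma aux_summable_pi (n : ℕ) (f : ℤ → ℝ) (hf : Summable f) (h0 : ∀ k, 0 ≤ f k) :
    Summable fun w : Fin n → ℤ => ∏ i, f (w i) := by
  classical
  refine summable_of_sum_le (c := ∏ _i : Fin n, ∑' k, f k)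
    (fun w => Finset.prod_nonneg fun i _ => h0 _) fun S => ?_
  have hsub : S ⊆ Fintype.piFinset fun i => S.image (fun w => w i) := by
    intro w hw
    rw [Fintype.mem_piFinset]
    intro i
    exact Finset.mem_image_of_mem _ hw
  calc _ ≤ ∑ w ∈ Fintype.piFinset fun i => S.image (fun w => w i), ∏ i, f (w i) :=
        Finset.sum_le_sum_of_subset_of_nonneg hsub fun w _ _ =>
          Finset.prod_nonneg fun i _ => h0 _
    _ = ∏ i, ∑ k ∈ S.image (fun w => w i), f k := by
        rw [Finset.prod_univ_sum]
    _ ≤ _ := Finset.prod_le_prod (fun i _ => Finset.sum_nonneg fun k _ => h0 _)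
        fun i _ => hf.sum_le_tsum _ fun k _ => h0 _

lemma aux_summable_exp (c : ℝ) (hc : 0 < c) : Summable fun k : ℤ => Real.exp (-c * (k:ℝ) ^ 2) := by
  have h : Summable fun k : ℤ => Real.exp (-c * |(k:ℝ)|) := by
    have hn : Summable fun k : ℕ => Real.exp (-c * (k:ℝ)) := by
      have := Real.summable_exp_nat_mul_iff (a := -c)
      simp_rw [mul_comm (-c)]
      exact this.2 (by linarith)
    refine Summable.of_nat_of_neg ?_ ?_ <;> simpa using hn
  refine h.of_nonneg_of_le (fun _ => (Real.exp_pos _).le) fun k => ?_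
  apply Real.exp_le_exp.2
  have : |(k:ℝ)| ≤ (k:ℝ)^2 := by
    rw [← sq_abs]
    rcases eq_or_ne k 0 with rfl | hk
    · simp
    · have : (1:ℝ) ≤ |(k:ℝ)| := by exact_mod_cast Int.one_le_abs hk
      nlinarith
  nlinarith

lemma aux_bound {n : ℕ} (M : Matrix (Fin n) (Fin n) ℝ) :
    ∃ K : ℝ, 0 < K ∧ ∀ x : Fin n → ℝ, ∑ i, (M.mulVec x i) ^ 2 ≤ K * ∑ i, x i ^ 2 := by
  refine ⟨(∑ i, ∑ j, M i j ^ 2) + 1, by positivity, fun x => ?_⟩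
  have : ∑ i, (M.mulVec x i) ^ 2 ≤ (∑ i, ∑ j, M i j ^ 2) * ∑ i, x i ^ 2 := by
    rw [Finset.sum_mul]
    exact Finset.sum_le_sum fun i _ => Finset.sum_mul_sq_le_sq_mul_sq Finset.univ (M i) x
  have h2 : 0 ≤ ∑ i, x i ^ 2 := by positivity
  linarith

/-- Summability over integer vectors. -/
lemma aux_summable_vec {n : ℕ} (D : Matrix (Fin n) (Fin n) ℝ) (hD : IsUnit D.det) (s : ℝ)
    (hs : 0 < s) :
    Summable fun w : Fin n → ℤ =>
      Real.exp (-π * s ^ 2 * ∑ j, (D.mulVec (fun i => (w i : ℝ)) j) ^ 2) := by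
  obtain ⟨K, hK, hb⟩ := aux_bound D⁻¹
  have hc : 0 < π * s ^ 2 / K := by have := Real.pi_pos; positivity
  refine (aux_summable_pi n _ (aux_summable_exp _ hc) fun _ => (Real.exp_pos _).le).of_nonneg_of_le
    (fun _ => (Real.exp_pos _).le) fun w => ?_
  rw [← Real.exp_sum, ← Finset.mul_sum]
  apply Real.exp_le_exp.2
  have := hb (D.mulVec (fun i => (w i : ℝ)))
  rw [Matrix.mulVec_mulVec, Matrix.nonsing_inv_mul _ hD, Matrix.one_mulVec] at this
  have h3 : π * s ^ 2 / K * ∑ i, (w i : ℝ) ^ 2 ≤ π * s ^ 2 / K *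
    (K * ∑ i, D.mulVec (fun i => (w i : ℝ)) i ^ 2) := mul_le_mul_of_nonneg_left this hc.le
  have h4 : π * s ^ 2 / K * (K * ∑ i, D.mulVec (fun i => (w i : ℝ)) i ^ 2) =
    π * s ^ 2 * ∑ i, D.mulVec (fun i => (w i : ℝ)) i ^ 2 := by field_simp
  linarith

lemma aux_tendsto {n : ℕ} (D : Matrix (Fin n) (Fin n) ℝ) (hD : IsUnit D.det) :
    Filter.Tendsto (fun s : ℝ => ∑' w : {w : Fin n → ℤ // w ≠ 0},
      Real.exp (-π * s ^ 2 * ∑ j, (D.mulVec (fun i => (w.1 i : ℝ)) j) ^ 2)) Filter.atTop (nhds 0) := by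
  have h := tendsto_tsum_of_dominated_convergence (𝓕 := Filter.atTop (α := ℝ))
    (f := fun (s : ℝ) (w : {w : Fin n → ℤ // w ≠ 0}) =>
      Real.exp (-π * s ^ 2 * ∑ j, (D.mulVec (fun i => (w.1 i : ℝ)) j) ^ 2)) (g := fun _ => 0)
    ((aux_summable_vec D hD 1 one_pos).comp_injective
      (i := fun w : {w : Fin n → ℤ // w ≠ 0} => w.1) Subtype.val_injective) ?_ ?_
  · simpa using h
  · intro w
    have hpos : 0 < ∑ j, (D.mulVec (fun i => (w.1 i : ℝ)) j) ^ 2 := by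
      refine lt_of_le_of_ne (by positivity) fun h0 => w.2 ?_
      have h1 : D.mulVec (fun i => (w.1 i : ℝ)) = 0 := by
        ext j
        have := (Finset.sum_eq_zero_iff_of_nonneg (fun j _ => sq_nonneg _)).1 h0.symm j
          (Finset.mem_univ j)
        exact pow_eq_zero_iff two_ne_zero |>.1 this
      have h2 : D⁻¹.mulVec (D.mulVec (fun i => (w.1 i : ℝ))) = 0 := by rw [h1]; simp
      rw [Matrix.mulVec_mulVec, Matrix.nonsing_inv_mul _ hD, Matrix.one_mulVec] at h2
      ext i
      have := congrFun h2 i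
      simpa using this
    refine Real.tendsto_exp_atBot.comp ?_
    have h1 : Filter.Tendsto (fun s : ℝ => s ^ 2) Filter.atTop Filter.atTop :=
      Filter.tendsto_pow_atTop two_ne_zero
    have h2 := h1.const_mul_atTop_of_neg (r := -π * ∑ j, (D.mulVec (fun i => (w.1 i : ℝ)) j) ^ 2)
      (by have := Real.pi_pos; nlinarith)
    refine h2.congr fun s => by ring
  · filter_upwards [Filter.eventually_ge_atTop 1] with s hs w
    rw [Real.norm_eq_abs, abs_of_pos (Real.exp_pos _)]
    apply Real.exp_le_exp.2
    have hpos : 0 ≤ ∑ j, (D.mulVec (fun i => (w.1 i : ℝ)) j) ^ 2 := by positivity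
    have : (1:ℝ) ^ 2 ≤ s ^ 2 := by nlinarith
    have := mul_le_mul_of_nonneg_left (mul_le_mul_of_nonneg_right this hpos) Real.pi_pos.le
    linarith

lemma aux_dual_mem {n : ℕ} (B : Matrix (Fin n) (Fin n) ℝ) (hB : IsUnit B.det) (w : Fin n → ℤ) :
    (B⁻¹).transpose.mulVec (fun i => (w i : ℝ)) ∈ dualLattice B := by
  rintro v ⟨z, rfl⟩
  refine ⟨∑ i, w i * z i, ?_⟩
  change (B⁻¹).transpose.mulVec (fun i => (w i : ℝ)) ⬝ᵥ B.mulVec (fun i => (z i : ℝ)) = _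
  rw [Matrix.mulVec_transpose, ← Matrix.dotProduct_mulVec, Matrix.mulVec_mulVec,
    Matrix.nonsing_inv_mul _ hB, Matrix.one_mulVec]
  simp [dotProduct]

lemma aux_dual_inv {n : ℕ} (B : Matrix (Fin n) (Fin n) ℝ) (hB : IsUnit B.det) (x : Fin n → ℝ) :
    B.transpose.mulVec ((B⁻¹).transpose.mulVec x) = x ∧
    (B⁻¹).transpose.mulVec (B.transpose.mulVec x) = x := by
  constructor
  · rw [Matrix.mulVec_mulVec, ← Matrix.transpose_mul, Matrix.nonsing_inv_mul _ hB]; simp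
  · rw [Matrix.mulVec_mulVec, ← Matrix.transpose_mul, Matrix.mul_nonsing_inv _ hB]; simp

lemma aux_dual_surj {n : ℕ} (B : Matrix (Fin n) (Fin n) ℝ) (hB : IsUnit B.det) (x : Fin n → ℝ)
    (hx : x ∈ dualLattice B) :
    ∃ w : Fin n → ℤ, (B⁻¹).transpose.mulVec (fun i => (w i : ℝ)) = x := by
  have : ∀ i, ∃ k : ℤ, B.transpose.mulVec x i = k := by
    intro i
    obtain ⟨k, hk⟩ := hx (B.mulVec fun j => ((Pi.single i 1 : Fin n → ℤ) j : ℝ)) ⟨_, rfl⟩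
    refine ⟨k, ?_⟩
    rw [← hk]
    have h1 : (fun j => ((Pi.single i 1 : Fin n → ℤ) j : ℝ)) = Pi.single i 1 := by
      ext j; by_cases h : j = i
      · subst h; simp
      · simp [h]
    rw [h1, Matrix.mulVec_single_one]
    simp [Matrix.mulVec, dotProduct, mul_comm]
  choose w hw using this
  refine ⟨w, ?_⟩
  have h2 : (fun i => (w i : ℝ)) = B.transpose.mulVec x := by ext i; rw [hw]
  rw [h2, (aux_dual_inv B hB x).2]

lemma aux_rho {n : ℕ} (B : Matrix (Fin n) (Fin n) ℝ) (hB : IsUnit B.det) (s : ℝ) :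
    rhoOnSet (1 / s) (dualLattice B \ {0}) = ∑' w : {w : Fin n → ℤ // w ≠ 0},
      Real.exp (-π * s ^ 2 * ∑ j, ((B⁻¹).transpose.mulVec (fun i => (w.1 i : ℝ)) j) ^ 2) := by
  have hinj : ∀ w v : Fin n → ℤ, (B⁻¹).transpose.mulVec (fun i => (w i : ℝ)) =
      (B⁻¹).transpose.mulVec (fun i => (v i : ℝ)) → w = v := by
    intro w v h
    have h1 := congrArg B.transpose.mulVec h
    rw [(aux_dual_inv B hB _).1, (aux_dual_inv B hB _).1] at h1
    ext i
    exact_mod_cast congrFun h1 i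
  let e : {w : Fin n → ℤ // w ≠ 0} → (dualLattice B \ {0} : Set (Fin n → ℝ)) := fun w =>
    ⟨(B⁻¹).transpose.mulVec (fun i => (w.1 i : ℝ)), aux_dual_mem B hB _, by
      intro h
      apply w.2
      apply hinj
      rw [Set.mem_singleton_iff.1 h]
      have : (fun i => (((0 : Fin n → ℤ) i : ℤ) : ℝ)) = 0 := by ext; simp
      rw [this, Matrix.mulVec_zero]⟩
  have he : Function.Bijective e := by
    constructor
    · intro w v h
      exact Subtype.ext (hinj _ _ (congrArg Subtype.val h))
    · rintro ⟨x, hx, hx0⟩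
      obtain ⟨w, hw⟩ := aux_dual_surj B hB x hx
      refine ⟨⟨w, ?_⟩, Subtype.ext hw⟩
      rintro rfl
      apply hx0
      rw [Set.mem_singleton_iff, ← hw]
      have : (fun i => (((0 : Fin n → ℤ) i : ℤ) : ℝ)) = 0 := by ext; simp
      rw [this, Matrix.mulVec_zero]
  rw [rhoOnSet, ← (Equiv.ofBijective e he).tsum_eq]
  refine tsum_congr fun w => ?_
  congr 1
  simp only [Equiv.ofBijective_apply, e]
  rw [one_div, inv_pow, div_inv_eq_mul]; ring

lemma aux_finite {n : ℕ} (B : Matrix (Fin n) (Fin n) ℝ) (hB : IsUnit B.det) (ε : ℝ) (hε : 0 < ε)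
    (s : ℝ) (hs : smoothingParam B ε ≤ s) (F : Finset (Fin n → ℤ)) (hF : 0 ∉ F) :
    ∑ w ∈ F, Real.exp (-π * s ^ 2 * ∑ j, ((B⁻¹).transpose.mulVec (fun i => (w i : ℝ)) j) ^ 2)
      ≤ ε := by
  have hD : IsUnit (B⁻¹).transpose.det := by
    rw [Matrix.det_transpose]; exact Matrix.isUnit_nonsing_inv_det _ hB
  set S : Set ℝ := {s : ℝ | 0 < s ∧ rhoOnSet (1 / s) (dualLattice B \ {0}) ≤ ε} with hS
  have hne : S.Nonempty := by
    have h1 := (aux_tendsto _ hD).eventually (gt_mem_nhds hε)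
    obtain ⟨r, hr, hr0⟩ := (h1.and (Filter.eventually_gt_atTop 0)).exists
    exact ⟨r, hr0, by rw [aux_rho B hB]; exact hr.le⟩
  have hs0 : 0 ≤ s := le_trans (Real.sInf_nonneg fun r hr => hr.1.le) hs
  have hfin : ∀ r ∈ S, ∑ w ∈ F, Real.exp (-π * r ^ 2 *
      ∑ j, ((B⁻¹).transpose.mulVec (fun i => (w i : ℝ)) j) ^ 2) ≤ ε := by
    rintro r ⟨hr, hrε⟩
    rw [aux_rho B hB] at hrε
    refine le_trans ?_ hrε
    have hsum := (aux_summable_vec _ hD r hr).comp_injective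
      (i := fun w : {w : Fin n → ℤ // w ≠ 0} => w.1) Subtype.val_injective
    have h2 := hsum.sum_le_tsum (F.subtype (fun w => w ≠ 0)) (fun _ _ => (Real.exp_pos _).le)
    refine le_trans (le_of_eq ?_) h2
    have h3 := Finset.sum_subtype_of_mem (s := F) (p := fun w => w ≠ 0)
      (fun w => Real.exp (-π * r ^ 2 *
      ∑ j, ((B⁻¹).transpose.mulVec (fun i => (w i : ℝ)) j) ^ 2))
      (fun w hw h => hF (h ▸ hw))
    rw [← h3]
  have hlim : Filter.Tendsto (fun r : ℝ => ∑ w ∈ F, Real.exp (-π * r ^ 2 *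
      ∑ j, ((B⁻¹).transpose.mulVec (fun i => (w i : ℝ)) j) ^ 2)) (nhdsWithin s (Set.Ioi s))
      (nhds (∑ w ∈ F, Real.exp (-π * s ^ 2 *
      ∑ j, ((B⁻¹).transpose.mulVec (fun i => (w i : ℝ)) j) ^ 2))) := by
    refine Filter.Tendsto.mono_left (Continuous.tendsto ?_ s) nhdsWithin_le_nhds
    fun_prop
  refine le_of_tendsto hlim ?_
  filter_upwards [self_mem_nhdsWithin] with r hr
  obtain ⟨q, hq, hqr⟩ := exists_lt_of_csInf_lt hne (lt_of_le_of_lt hs hr)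
  refine le_trans (Finset.sum_le_sum fun w _ => ?_) (hfin q hq)
  apply Real.exp_le_exp.2
  have hpos : 0 ≤ ∑ j, ((B⁻¹).transpose.mulVec (fun i => (w i : ℝ)) j) ^ 2 := by positivity
  have h5 : q ^ 2 ≤ r ^ 2 := by have := hq.1; gcongr
  have := mul_le_mul_of_nonneg_left (mul_le_mul_of_nonneg_right h5 hpos) Real.pi_pos.le
  linarith

/-- Gaussian smoothing: if `s ≥ η_ε(L(B))`, then the Gaussian `N(μ, (s²/2π)·I_n)`
reduced mod `P(B)` is within total variation distance `ε/2` of uniform on `P(B)`. -/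
theorem stmt10 (n : ℕ) (B : Matrix (Fin n) (Fin n) ℝ) (hB : IsUnit B.det)
    (ε : ℝ) (hε : 0 < ε) (s : ℝ) (hs : smoothingParam B ε ≤ s)
    (μ : Fin n → ℝ) :
    ∀ A : Set (Fin n → ℝ), MeasurableSet A →
      |((((Measure.pi fun i : Fin n =>
              gaussianReal (μ i) (Real.toNNReal (s ^ 2 / (2 * π)))).map
            (reduceModP B)) A).toReal - ((uniformP B) A).toReal)| ≤ ε / 2 := by
  intro A hA
  set γ := Measure.pi fun i : Fin n =>
    gaussianReal (μ i) (Real.toNNReal (s ^ 2 / (2 * π))) with hγ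
  set U := Measure.pi fun _ : Fin n => (volume : Measure ℝ).restrict (Set.Ico (0 : ℝ) 1) with hU
  have : IsProbabilityMeasure ((volume : Measure ℝ).restrict (Set.Ico (0 : ℝ) 1)) :=
    ⟨by simp⟩
  have hBm : Measurable B.mulVec := Continuous.measurable (by fun_prop)
  have hm : Measurable (fun x => toTorus ((B⁻¹).mulVec x)) :=
    measurable_toTorus.comp (Continuous.measurable (by fun_prop))
  have hr : Measurable (fun t => B.mulVec (ofTorus (n := n) t)) := hBm.comp measurable_ofTorus
  have hred : reduceModP B = (fun t => B.mulVec (ofTorus t)) ∘ (fun x => toTorus ((B⁻¹).mulVec x)) := by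
    ext1 x
    simp only [Function.comp, reduceModP, ofTorus_toTorus]
  have huni : uniformP B = (U.map toTorus).map (fun t => B.mulVec (ofTorus t)) := by
    rw [Measure.map_map hr measurable_toTorus, uniformP]
    refine Measure.map_congr ?_
    have hae : ∀ᵐ x ∂U, ∀ i, x i ∈ Set.Ico (0:ℝ) 1 := by
      rw [ae_all_iff]
      intro i
      exact (Measure.quasiMeasurePreserving_eval (μ := fun _ : Fin n =>
        (volume : Measure ℝ).restrict (Set.Ico (0 : ℝ) 1)) i).ae (ae_restrict_mem measurableSet_Ico)
    filter_upwards [hae] with x hx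
    simp only [Function.comp, ofTorus_toTorus]
    congr 1
    ext i
    exact (Int.fract_eq_self.2 (hx i)).symm
  rw [huni, hred, ← Measure.map_map hr hm, Measure.map_apply hr hA, Measure.map_apply hr hA]
  have : IsProbabilityMeasure (γ.map (fun x => toTorus ((B⁻¹).mulVec x))) :=
    Measure.isProbabilityMeasure_map hm.aemeasurable
  have : IsProbabilityMeasure (U.map toTorus) :=
    Measure.isProbabilityMeasure_map measurable_toTorus.aemeasurable
  refine aux_tv _ _ ε hε (fun w => aux_V w) (fun F hF => ?_) _ (hr hA)
  simp_rw [hγ, aux_nu]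
  exact aux_finite B hB ε hε s hs F hF

end
end

section
/- For any invertible B ∈ ℝ^{n×n}, ε > 0, and μ ∈ ℝ^n, if σ ≥ √(ln(2n(1+1/ε))/(2π²)) · λ_n(L(B)), then the total variation distance between (N(μ, σ² I_n) mod P(B)) and the uniform distribution on P(B) is at most ε/2. -/
open MeasureTheory ProbabilityTheory
open scoped BigOperators Real

noncomputable section

/-- Euclidean norm on `ℝ^n`. -/
def enorm2 {n : ℕ} (x : Fin n → ℝ) : ℝ := Real.sqrt (∑ i, x i ^ 2)

/-- The `n`-th successive minimum `λ_n(L(B))`. -/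
def lambdaN {n : ℕ} (B : Matrix (Fin n) (Fin n) ℝ) : ℝ :=
  sInf {r : ℝ | ∃ v : Fin n → (Fin n → ℝ),
    LinearIndependent ℝ v ∧ ∀ i, v i ∈ latticeSet B ∧ enorm2 (v i) ≤ r}

lemma aux_fiber_nonneg {G : Type*} [AddCommGroup G]
    (htf : ∀ g h : G, g + g = h + h → g = h) (b : G → ℝ) (hb : Summable fun g => ‖b g‖) :
    0 ≤ ∑' p : G × G, b (p.1 + p.2) * b (p.1 - p.2) := by
  classical
  let D : G →+ G := AddMonoidHom.mk' (fun g => g + g) (by intro a b; abel)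
  let Q := G ⧸ D.range
  let mk : G → Q := QuotientAddGroup.mk
  let F : G × G → ℝ := fun p => if mk p.1 = mk p.2 then b p.1 * b p.2 else 0
  have hsum : Summable fun p : G × G => b p.1 * b p.2 := summable_mul_of_summable_norm hb hb
  have hFs : Summable F := by
    refine Summable.of_norm_bounded hsum.norm ?_
    intro p
    simp only [F]
    split_ifs
    · exact le_rfl
    · rw [norm_zero]; exact norm_nonneg _
  let e1 : G × G → G × G := fun p => (p.1 + p.2, p.1 - p.2)
  have he1 : Function.Injective e1 := by
    rintro ⟨a, b⟩ ⟨c, d⟩ h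
    simp only [e1, Prod.mk.injEq] at h
    obtain ⟨h1, h2⟩ := h
    have h3 : a = c := by
      apply htf
      have : (a + b) + (a - b) = (c + d) + (c - d) := by rw [h1, h2]
      calc a + a = (a + b) + (a - b) := by abel
        _ = (c + d) + (c - d) := this
        _ = c + c := by abel
    subst h3
    simpa using h1
  have hmk : ∀ u v : G, mk u = mk v ↔ ∃ g, g + g = -u + v := by
    intro u v
    simp only [mk]
    rw [QuotientAddGroup.eq]
    rfl
  have hFe1 : ∀ p, F (e1 p) = b (p.1 + p.2) * b (p.1 - p.2) := by
    intro p
    simp only [F, e1]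
    rw [if_pos]
    rw [hmk]
    exact ⟨-p.2, by abel⟩
  have hsup1 : Function.support F ⊆ Set.range e1 := by
    rintro ⟨u, v⟩ h
    have : mk u = mk v := by
      by_contra hne
      exact h (by simp [F, hne])
    rw [hmk] at this
    obtain ⟨g, hg⟩ := this
    refine ⟨(u + g, -g), ?_⟩
    simp only [e1, Prod.mk.injEq]
    constructor
    · abel
    · have : v = u + (g + g) := by rw [hg]; abel
      rw [this]; abel
  have h1 : ∑' p : G × G, b (p.1 + p.2) * b (p.1 - p.2) = ∑' p, F p := by
    rw [← he1.tsum_eq hsup1]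
    exact tsum_congr fun p => (hFe1 p).symm
  let fib : Q → Type _ := fun q => {g : G // mk g = q}
  let e2 : (Σ q : Q, fib q × fib q) → G × G := fun x => (x.2.1.1, x.2.2.1)
  have he2 : Function.Injective e2 := by
    rintro ⟨q, ⟨a, ha⟩, ⟨b, hb⟩⟩ ⟨q', ⟨a', ha'⟩, ⟨b', hb'⟩⟩ h
    simp only [e2, Prod.mk.injEq] at h
    obtain ⟨h1, h2⟩ := h
    subst h1 h2
    subst ha
    subst ha'
    rfl
  have hsup2 : Function.support F ⊆ Set.range e2 := by
    rintro ⟨u, v⟩ h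
    have : mk u = mk v := by
      by_contra hne
      exact h (by simp [F, hne])
    exact ⟨⟨mk u, ⟨u, rfl⟩, ⟨v, this.symm⟩⟩, rfl⟩
  rw [h1, ← he2.tsum_eq hsup2]
  have hs2 : Summable fun x => F (e2 x) := hFs.comp_injective he2
  rw [hs2.tsum_sigma]
  refine tsum_nonneg fun q => ?_
  have hbq : Summable fun g : fib q => ‖b g.1‖ := hb.comp_injective Subtype.val_injective
  have : ∑' c : fib q × fib q, F (e2 ⟨q, c⟩) = (∑' g : fib q, b g.1) * ∑' g : fib q, b g.1 := by
    rw [tsum_mul_tsum_of_summable_norm hbq hbq]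
    refine tsum_congr fun p => ?_
    simp only [F, e2]
    rw [if_pos]
    rw [p.1.2, p.2.2]
  rw [this]
  exact mul_self_nonneg _

lemma aux_shift {G : Type*} [AddCommGroup G]
    (htf : ∀ g h : G, g + g = h + h → g = h)
    {E : Type*} [NormedAddCommGroup E] [InnerProductSpace ℝ E] (φ : G →+ E) (c : ℝ) (hc : 0 < c)
    (hs : ∀ c : ℝ, 0 < c → ∀ x, Summable fun g => Real.exp (-c * ‖φ g + x‖ ^ 2))
    (C : ℝ) (hC : ∀ x, ∑' g, Real.exp (-c * ‖φ g + x‖ ^ 2) ≤ C) (x : E) :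
    ∑' g, Real.exp (-c * ‖φ g + x‖ ^ 2) ≤ ∑' g, Real.exp (-c * ‖φ g‖ ^ 2) := by
  set f : E → ℝ := fun x => ∑' g, Real.exp (-c * ‖φ g + x‖ ^ 2) with hf
  have hf0 : ∑' g, Real.exp (-c * ‖φ g‖ ^ 2) = f 0 := by simp [hf]
  rw [hf0]
  change f x ≤ f 0
  let α : E → ℝ := fun y => Real.exp (-(c / 2) * ‖y‖ ^ 2)
  have hpar : ∀ a b : E, Real.exp (-c * ‖a‖ ^ 2) * Real.exp (-c * ‖b‖ ^ 2) = α (a + b) * α (a - b) := by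
    intro a b
    simp only [α]
    rw [← Real.exp_add, ← Real.exp_add]
    congr 1
    have := parallelogram_law_with_norm ℝ a b
    nlinarith
  have hsn : ∀ x, Summable fun g => ‖Real.exp (-c * ‖φ g + x‖ ^ 2)‖ := fun x => (hs c hc x).norm
  have hprod : ∀ x y, HasSum (fun p : G × G => α (φ (p.1 + p.2) + (x + y)) * α (φ (p.1 - p.2) + (x - y)))
      (f x * f y) := by
    intro x y
    have h1 : Summable fun p : G × G => Real.exp (-c * ‖φ p.1 + x‖ ^ 2) * Real.exp (-c * ‖φ p.2 + y‖ ^ 2) :=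
      summable_mul_of_summable_norm (hsn x) (hsn y)
    have h2 := h1.hasSum
    rw [← tsum_mul_tsum_of_summable_norm (hsn x) (hsn y)] at h2
    convert h2 using 2 with p
    rw [hpar]
    congr 2
    · rw [map_add]; abel
    · rw [map_sub]; abel
  have hneg : ∀ t, f (-t) = f t := by
    intro t
    simp only [hf]
    rw [← (Equiv.neg G).tsum_eq]
    refine tsum_congr fun g => ?_
    rw [← norm_neg (φ g + t)]
    simp [add_comm]
  have key : ∀ t, 2 * f t ^ 2 ≤ f (t + t) * f 0 + f 0 ^ 2 := by
    intro t
    let b : G → ℝ := fun g => α (φ g + (t + t)) - α (φ g)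
    have hb : Summable fun g => ‖b g‖ := by
      have := (hs (c/2) (by positivity) (t + t)).sub (hs (c/2) (by positivity) 0)
      refine (this.congr ?_).norm
      intro g
      simp [b, α]
    have h0 := aux_fiber_nonneg htf b hb
    have h1 := (((hprod (t + t) 0).add (hprod 0 0)).sub (hprod t t)).sub (hprod t (-t))
    have h2 : ∑' p : G × G, b (p.1 + p.2) * b (p.1 - p.2) =
        f (t + t) * f 0 + f 0 * f 0 - f t * f t - f t * f (-t) := by
      rw [← h1.tsum_eq]
      refine tsum_congr fun p => ?_
      simp only [b, add_zero, sub_zero, sub_self, add_neg_cancel, sub_neg_eq_add]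
      ring
    rw [h2, hneg] at h0
    nlinarith
  have hbdd : BddAbove (Set.range f) := ⟨C, by rintro _ ⟨x, rfl⟩; exact hC x⟩
  set S := ⨆ t, f t with hS
  have hle : ∀ t, f t ≤ S := fun t => le_ciSup hbdd t
  have hpos : ∀ t, 0 < f t := by
    intro t
    exact (hs c hc t).tsum_pos (fun g => (Real.exp_pos _).le) 0 (Real.exp_pos _)
  have h2 : ∀ t, f t ≤ Real.sqrt ((S * f 0 + f 0 ^ 2) / 2) := by
    intro t
    apply Real.le_sqrt_of_sq_le
    nlinarith [key t, hle (t + t), hpos 0]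
  have h3 : S ≤ Real.sqrt ((S * f 0 + f 0 ^ 2) / 2) := ciSup_le h2
  have hSp : 0 < S := (hpos 0).trans_le (hle 0)
  have h4 : S ^ 2 ≤ (S * f 0 + f 0 ^ 2) / 2 := by
    calc S ^ 2 ≤ Real.sqrt ((S * f 0 + f 0 ^ 2) / 2) ^ 2 := by gcongr
      _ = _ := Real.sq_sqrt (by nlinarith [hpos 0, mul_pos hSp (hpos 0)])
  have h5 : S ≤ f 0 := by
    by_contra hcon
    push Not at hcon
    nlinarith [hpos 0, mul_pos hSp (sub_pos.2 hcon), mul_pos (hpos 0) (sub_pos.2 hcon)]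
  exact (hle x).trans h5

lemma aux_int_summable (c : ℝ) (hc : 0 < c) : Summable fun k : ℤ => Real.exp (-c * (k : ℝ) ^ 2) := by
  have h1 : Summable fun k : ℕ => Real.exp (-c * (k : ℝ)) := by
    have := summable_geometric_of_lt_one (Real.exp_pos (-c)).le (by simpa using hc)
    refine this.congr fun k => ?_
    rw [← Real.exp_nat_mul]; ring_nf
  have h2 : Summable fun k : ℕ => Real.exp (-c * (k : ℝ) ^ 2) := by
    refine Summable.of_nonneg_of_le (fun _ => (Real.exp_pos _).le) (fun k => ?_) h1
    apply Real.exp_le_exp.2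
    have : (k : ℝ) ≤ (k : ℝ) ^ 2 := by exact_mod_cast Nat.le_self_pow two_ne_zero k
    nlinarith
  refine Summable.of_nat_of_neg ?_ ?_
  · simpa using h2
  · simpa using h2

lemma aux_pi_summable (c : ℝ) (hc : 0 < c) (n : ℕ) :
    Summable fun k : Fin n → ℤ => Real.exp (-c * ∑ i, (k i : ℝ) ^ 2) := by
  induction n with
  | zero => exact Summable.of_finite
  | succ n ih =>
    rw [← (Fin.consEquiv (fun _ => ℤ)).summable_iff]
    have := Summable.mul_of_nonneg (aux_int_summable c hc) ih
      (fun _ => (Real.exp_pos _).le) (fun _ => (Real.exp_pos _).le)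
    refine this.congr ?_
    intro p
    simp only [Function.comp, Fin.consEquiv, Equiv.coe_fn_mk, Fin.sum_univ_succ, Fin.cons_zero,
      Fin.cons_succ]
    rw [← Real.exp_add]
    congr 1
    ring

/-- Integer vectors as points of Euclidean space. -/
def castZ (n : ℕ) : (Fin n → ℤ) →+ EuclideanSpace ℝ (Fin n) where
  toFun k := WithLp.toLp 2 fun i => (k i : ℝ)
  map_zero' := by ext i; simp
  map_add' a b := by ext i; simp

lemma castZ_apply {n : ℕ} (k : Fin n → ℤ) (i : Fin n) : castZ n k i = (k i : ℝ) := rfl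

lemma aux_T_bound {n : ℕ} (T : EuclideanSpace ℝ (Fin n) ≃L[ℝ] EuclideanSpace ℝ (Fin n))
    (c : ℝ) (hc : 0 < c) : ∃ C : ℝ, ∀ x,
      (Summable fun k : Fin n → ℤ => Real.exp (-c * ‖T (castZ n k) + x‖ ^ 2)) ∧
      ∑' k : Fin n → ℤ, Real.exp (-c * ‖T (castZ n k) + x‖ ^ 2) ≤ C := by
  set K : ℝ := ‖(T.symm : EuclideanSpace ℝ (Fin n) →L[ℝ] EuclideanSpace ℝ (Fin n))‖ + 1 with hK
  have hKpos : 0 < K := by positivity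
  have hlow : ∀ y, ‖y‖ ≤ K * ‖T y‖ := by
    intro y
    have h := (T.symm : EuclideanSpace ℝ (Fin n) →L[ℝ] EuclideanSpace ℝ (Fin n)).le_opNorm (T y)
    simp only [ContinuousLinearEquiv.coe_coe, ContinuousLinearEquiv.symm_apply_apply] at h
    refine h.trans ?_
    gcongr
    simp [hK]
  set c' := c / K ^ 2 with hc'
  have hc'pos : 0 < c' := by positivity
  let g : (Fin n → ℤ) → ℝ := fun k => Real.exp (c' * n) * Real.exp (-(c' / 2) * ∑ i, (k i : ℝ) ^ 2)
  have hg : Summable g := (aux_pi_summable (c' / 2) (by positivity) n).mul_left _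
  refine ⟨∑' k, g k, fun x => ?_⟩
  set t := T.symm x with ht
  let fl : Fin n → ℤ := fun i => ⌊t i⌋
  have hg' : Summable fun k => g (k + fl) := hg.comp_injective (Equiv.addRight fl).injective
  have hgt : ∑' k, g (k + fl) = ∑' k, g k := (Equiv.addRight fl).tsum_eq g
  have hle : ∀ k, Real.exp (-c * ‖T (castZ n k) + x‖ ^ 2) ≤ g (k + fl) := by
    intro k
    simp only [g]
    rw [← Real.exp_add]
    apply Real.exp_le_exp.2
    have h1 : T (castZ n k) + x = T (castZ n k + t) := by simp [ht]
    have h2 := hlow (castZ n k + t)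
    have h3 : ‖castZ n k + t‖ ^ 2 ≤ K ^ 2 * ‖T (castZ n k + t)‖ ^ 2 := by
      rw [← mul_pow]; gcongr
    have h4 : c' * ‖castZ n k + t‖ ^ 2 ≤ c * ‖T (castZ n k) + x‖ ^ 2 := by
      rw [h1, hc', div_mul_eq_mul_div, div_le_iff₀ (by positivity)]
      nlinarith
    have h5 : ∑ i, (((k + fl) i : ℤ) : ℝ) ^ 2 / 2 - n ≤ ‖castZ n k + t‖ ^ 2 := by
      rw [EuclideanSpace.norm_sq_eq]
      have : (n : ℝ) = ∑ i : Fin n, (1 : ℝ) := by simp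
      rw [this, ← Finset.sum_sub_distrib]
      refine Finset.sum_le_sum fun i _ => ?_
      rw [Real.norm_eq_abs, sq_abs, PiLp.add_apply, castZ_apply]
      have hfr := Int.fract_add_floor (t i)
      have h0 := Int.fract_nonneg (t i)
      have h1 := (Int.fract_lt_one (t i)).le
      simp only [Pi.add_apply, fl, Int.cast_add]
      set θ := Int.fract (t i)
      set m : ℝ := (k i : ℝ) + (⌊t i⌋ : ℝ) with hm
      have : (k i : ℝ) + t i = m + θ := by rw [hm]; linarith
      rw [this]
      nlinarith [sq_nonneg (m + 2 * θ)]
    rw [← Finset.sum_div] at h5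
    nlinarith
  have hs : Summable fun k : Fin n → ℤ => Real.exp (-c * ‖T (castZ n k) + x‖ ^ 2) :=
    Summable.of_nonneg_of_le (fun _ => (Real.exp_pos _).le) hle hg'
  refine ⟨hs, ?_⟩
  rw [← hgt]
  exact hs.tsum_le_tsum hle hg'

lemma aux_geom (x : ℝ) (hx0 : 0 < x) (hx1 : x < 1) :
    HasSum (fun j : ℤ => if j = 0 then 0 else x ^ j.natAbs) (2 * (x / (1 - x))) := by
  have h1 : HasSum (fun m : ℕ => x ^ (m + 1)) (x / (1 - x)) := by
    have := (hasSum_geometric_of_lt_one hx0.le hx1).mul_left x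
    rw [div_eq_mul_inv]
    have hfun : (fun m : ℕ => x ^ (m + 1)) = fun m => x * x ^ m := by
      funext m; ring
    rw [hfun]; exact this
  rw [two_mul]
  refine HasSum.of_nat_of_neg_add_one ?_ ?_
  · rw [← hasSum_nat_add_iff' 1]
    have hfun : (fun m : ℕ => (if ((m + 1 : ℕ) : ℤ) = 0 then 0 else x ^ ((m + 1 : ℕ) : ℤ).natAbs)) =
        fun m : ℕ => x ^ (m + 1) := by
      funext m
      rw [if_neg (by omega), Int.natAbs_natCast]
    rw [hfun]
    simpa using h1
  · convert h1 using 2 with m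
    rw [if_neg (by omega)]
    congr 1

lemma aux_half {n : ℕ} (T : EuclideanSpace ℝ (Fin n) ≃L[ℝ] EuclideanSpace ℝ (Fin n))
    (c : ℝ) (hc : 0 < c) (v : EuclideanSpace ℝ (Fin n)) (hv : v ≠ 0)
    (ψ : (Fin n → ℤ) →+ ℤ) (hψ : ∀ k, inner ℝ (T (castZ n k)) v = (ψ k : ℝ)) :
    (∑' k : Fin n → ℤ, if ψ k = 0 then 0 else Real.exp (-c * ‖T (castZ n k)‖ ^ 2)) *
      (Real.exp (c / ‖v‖ ^ 2) + 1) ≤ 2 * ∑' k : Fin n → ℤ, Real.exp (-c * ‖T (castZ n k)‖ ^ 2) := by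
  classical
  set w : (Fin n → ℤ) → ℝ := fun k => Real.exp (-c * ‖T (castZ n k)‖ ^ 2) with hw
  have hwpos : ∀ k, 0 < w k := fun k => Real.exp_pos _
  have hsall : ∀ c : ℝ, 0 < c → ∀ x, Summable fun k : Fin n → ℤ => Real.exp (-c * ‖T (castZ n k) + x‖ ^ 2) := by
    intro c hc x
    obtain ⟨C, hC⟩ := aux_T_bound T c hc
    exact (hC x).1
  have hws : Summable w := by simpa [hw] using hsall c hc 0
  let Tj : ℤ → ℝ := fun j => ∑' k : {k // ψ k = j}, w k
  have hvn : 0 < ‖v‖ := norm_pos_iff.2 hv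
  set x := Real.exp (-(c / ‖v‖ ^ 2)) with hx
  have hx0 : 0 < x := Real.exp_pos _
  have hx1 : x < 1 := by rw [hx, Real.exp_lt_one_iff]; simp; positivity
  -- the shift bound
  have hTj : ∀ j, Tj j ≤ Real.exp (-(c / ‖v‖ ^ 2) * (j : ℝ) ^ 2) * Tj 0 := by
    intro j
    by_cases hne : ∃ k0, ψ k0 = j
    · obtain ⟨k0, hk0⟩ := hne
      let e : ψ.ker ≃ {k // ψ k = j} :=
        { toFun := fun m => ⟨m.1 + k0, by rw [map_add, hk0, (AddMonoidHom.mem_ker).1 m.2, zero_add]⟩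
          invFun := fun k => ⟨k.1 - k0, by rw [AddMonoidHom.mem_ker, map_sub, hk0, k.2, sub_self]⟩
          left_inv := fun m => by ext; simp
          right_inv := fun m => by ext; simp }
      let φ : ψ.ker →+ EuclideanSpace ℝ (Fin n) :=
        ((T : EuclideanSpace ℝ (Fin n) →+ EuclideanSpace ℝ (Fin n)).comp (castZ n)).comp ψ.ker.subtype
      have hφ : ∀ m, φ m = T (castZ n m.1) := fun m => rfl
      let t : EuclideanSpace ℝ (Fin n) := T (castZ n k0) - ((j : ℝ) / ‖v‖ ^ 2) • v
      have htv : inner ℝ t v = 0 := by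
        simp only [t]
        rw [inner_sub_left, hψ, hk0, inner_smul_left, real_inner_self_eq_norm_sq]
        simp only [conj_trivial]
        field_simp
        simp
      have hkey := aux_shift (G := ψ.ker) (by
          intro g h hgh
          ext i
          have := congrFun (congrArg Subtype.val hgh) i
          simp only [AddSubgroup.coe_add, Pi.add_apply] at this
          omega) φ c hc
        (fun c hc x => (hsall c hc x).comp_injective Subtype.val_injective)
        (Classical.choose (aux_T_bound T c hc)) (by
          intro y
          have h := Classical.choose_spec (aux_T_bound T c hc) y
          refine le_trans ?_ h.2
          exact h.1.tsum_subtype_le _ (ψ.ker : Set (Fin n → ℤ)) (fun _ => (Real.exp_pos _).le)) t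
      have hT0 : Tj 0 = ∑' g, Real.exp (-c * ‖φ g‖ ^ 2) := rfl
      have : Tj j = Real.exp (-(c / ‖v‖ ^ 2) * (j : ℝ) ^ 2) * ∑' g, Real.exp (-c * ‖φ g + t‖ ^ 2) := by
        rw [← tsum_mul_left]
        simp only [Tj]
        rw [← e.tsum_eq]
        refine tsum_congr fun m => ?_
        rw [← Real.exp_add]
        simp only [hw]
        congr 1
        have h1 : T (castZ n (e m).1) = (φ m + t) + ((j : ℝ) / ‖v‖ ^ 2) • v := by
          simp only [e, t, hφ, Equiv.coe_fn_mk, map_add]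
          abel
        have h2 : inner ℝ (φ m + t) (((j : ℝ) / ‖v‖ ^ 2) • v) = 0 := by
          rw [inner_smul_right, inner_add_left, htv, hφ, hψ, (AddMonoidHom.mem_ker).1 m.2]
          simp
        have h3 := norm_add_sq_eq_norm_sq_add_norm_sq_of_inner_eq_zero _ _ h2
        rw [h1, sq, h3, norm_smul, Real.norm_eq_abs, abs_div, abs_of_nonneg (sq_nonneg ‖v‖)]
        have h4 : |(j : ℝ)| * |(j : ℝ)| = (j : ℝ) ^ 2 := by rw [← sq, sq_abs]
        rw [← h4]
        field_simp
        ring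
      rw [this, hT0]
      gcongr
    · have : Tj j = 0 := by
        have : IsEmpty {k // ψ k = j} := ⟨fun k => hne ⟨k.1, k.2⟩⟩
        simp [Tj]
      rw [this]
      have : 0 ≤ Tj 0 := tsum_nonneg fun k => (hwpos _).le
      positivity
  have hT0 : 0 ≤ Tj 0 := tsum_nonneg fun k => (hwpos _).le
  let F : (Fin n → ℤ) → ℝ := fun k => if ψ k = 0 then 0 else w k
  have hFs : Summable F := by
    refine Summable.of_nonneg_of_le (fun k => ?_) (fun k => ?_) hws
    · simp only [F]; split_ifs
      · exact le_rfl
      · exact (hwpos k).le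
    · simp only [F]; split_ifs
      · exact (hwpos k).le
      · exact le_rfl
  have hfib : ∀ f : (Fin n → ℤ) → ℝ, Summable f →
      HasSum (fun j : ℤ => ∑' k : {k // ψ k = j}, f k) (∑' k, f k) := by
    intro f hf
    exact hf.hasSum.tsum_fiberwise ψ
  have hF := hfib F hFs
  have hFj : ∀ j : ℤ, ∑' k : {k // ψ k = j}, F k = if j = 0 then 0 else Tj j := by
    intro j
    split_ifs with h
    · subst h
      simp only [F]
      refine (tsum_congr fun k => ?_).trans tsum_zero
      rw [if_pos k.2]
    · refine tsum_congr fun k => ?_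
      simp only [F]
      rw [if_neg]
      rw [k.2]; exact h
  have hW1 : ∑' k, F k ≤ 2 * (x / (1 - x)) * Tj 0 := by
    refine hasSum_le (fun j => ?_) hF ((aux_geom x hx0 hx1).mul_right (Tj 0))
    rw [hFj]
    split_ifs with h
    · simp
    · refine (hTj j).trans ?_
      gcongr
      rw [hx, ← Real.exp_nat_mul]
      apply Real.exp_le_exp.2
      have : ((j.natAbs : ℕ) : ℝ) ≤ (j : ℝ) ^ 2 := by
        have : (j.natAbs : ℤ) ≤ j ^ 2 := by
          rw [← Int.natAbs_sq]
          exact_mod_cast Nat.le_self_pow two_ne_zero _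
        have h' : ((j.natAbs : ℤ) : ℝ) ≤ ((j ^ 2 : ℤ) : ℝ) := Int.cast_le.2 this
        rw [Int.cast_natCast, Int.cast_pow] at h'
        exact h'
      have hp : 0 < c / ‖v‖ ^ 2 := by positivity
      nlinarith
  have hW : ∑' k, F k + Tj 0 = ∑' k, w k := by
    have h1 : Tj 0 = ∑' k, ({k | ψ k = 0} : Set _).indicator w k := tsum_subtype _ _
    rw [h1, ← hFs.tsum_add (hws.indicator _)]
    refine tsum_congr fun k => ?_
    simp only [F, Set.indicator_apply, Set.mem_ofPred_eq]
    split_ifs <;> simp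
  have hX : Real.exp (c / ‖v‖ ^ 2) = x⁻¹ := by rw [hx, Real.exp_neg, inv_inv]
  rw [hX]
  change (∑' k, F k) * _ ≤ 2 * ∑' k, w k
  rw [← hW]
  have h1 : 0 < 1 - x := by linarith
  have h2 : (∑' k, F k) * (1 - x) ≤ 2 * x * Tj 0 := by
    calc (∑' k, F k) * (1 - x) ≤ (2 * (x / (1 - x)) * Tj 0) * (1 - x) := by gcongr
      _ = _ := by field_simp
  have h3 : ((∑' k, F k) * (x⁻¹ + 1)) * x ≤ (2 * (∑' k, F k + Tj 0)) * x := by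
    have : ((∑' k, F k) * (x⁻¹ + 1)) * x = (∑' k, F k) * (1 + x) := by field_simp
    rw [this]
    nlinarith
  exact le_of_mul_le_mul_right h3 hx0

lemma aux_smoothing {n : ℕ} (hn : 0 < n)
    (T : EuclideanSpace ℝ (Fin n) ≃L[ℝ] EuclideanSpace ℝ (Fin n))
    (c : ℝ) (hc : 0 < c) (v : Fin n → EuclideanSpace ℝ (Fin n)) (hv : ∀ i, v i ≠ 0)
    (ψ : Fin n → ((Fin n → ℤ) →+ ℤ)) (hψ : ∀ i k, inner ℝ (T (castZ n k)) (v i) = (ψ i k : ℝ))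
    (hinj : ∀ k, (∀ i, ψ i k = 0) → k = 0) (ε : ℝ) (hε : 0 < ε)
    (hE : ∀ i, 2 * n * (1 + 1 / ε) ≤ Real.exp (c / ‖v i‖ ^ 2) + 1) :
    (Summable fun k : Fin n → ℤ => Real.exp (-c * ‖T (castZ n k)‖ ^ 2)) ∧
    ∑' k : Fin n → ℤ, (if k = 0 then 0 else Real.exp (-c * ‖T (castZ n k)‖ ^ 2)) ≤ ε := by
  classical
  set w : (Fin n → ℤ) → ℝ := fun k => Real.exp (-c * ‖T (castZ n k)‖ ^ 2) with hw
  have hwpos : ∀ k, 0 < w k := fun k => Real.exp_pos _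
  have hws : Summable w := by
    obtain ⟨C, hC⟩ := aux_T_bound T c hc
    simpa [hw] using (hC 0).1
  refine ⟨hws, ?_⟩
  change ∑' k, (if k = 0 then 0 else w k) ≤ ε
  have hsP : ∀ (P : (Fin n → ℤ) → Prop) [DecidablePred P],
      Summable fun k => if P k then 0 else w k := by
    intro P _
    refine Summable.of_nonneg_of_le (fun k => ?_) (fun k => ?_) hws
    · split_ifs
      · exact le_rfl
      · exact (hwpos k).le
    · split_ifs
      · exact (hwpos k).le
      · exact le_rfl
  set N := ∑' k, (if k = 0 then 0 else w k) with hN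
  have hρ : ∑' k, w k = 1 + N := by
    rw [hws.tsum_eq_add_tsum_ite 0]
    simp [hw, hN]
  have hunion : N ≤ ∑ i, ∑' k, (if ψ i k = 0 then 0 else w k) := by
    rw [← Summable.tsum_finsetSum (fun i _ => hsP (fun k => ψ i k = 0))]
    refine (hsP (fun k => k = 0)).tsum_le_tsum (fun k => ?_) (summable_sum fun i _ => hsP (fun k => ψ i k = 0))
    have hnn : ∀ i ∈ Finset.univ, 0 ≤ (if ψ i k = 0 then 0 else w k) := by
      intro i _
      split_ifs
      · exact le_rfl
      · exact (hwpos k).le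
    split_ifs with h
    · exact Finset.sum_nonneg hnn
    · have : ∃ i, ψ i k ≠ 0 := by
        by_contra hcon
        push Not at hcon
        exact h (hinj k hcon)
      obtain ⟨i, hi⟩ := this
      refine le_trans ?_ (Finset.single_le_sum hnn (Finset.mem_univ i))
      rw [if_neg hi]
  set Ee : ℝ := 2 * n * (1 + 1 / ε) with hEe
  have hi : ∀ i, (∑' k, (if ψ i k = 0 then 0 else w k)) * Ee ≤ 2 * (1 + N) := by
    intro i
    rw [← hρ]
    refine le_trans ?_ (aux_half T c hc (v i) (hv i) (ψ i) (hψ i))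
    apply mul_le_mul_of_nonneg_left (hE i)
    refine tsum_nonneg fun k => ?_
    split_ifs
    · exact le_rfl
    · exact (hwpos k).le
  have hnpos : (0 : ℝ) < n := by exact_mod_cast hn
  have hEpos : 0 < Ee := by positivity
  have h1 : N * Ee ≤ n * (2 * (1 + N)) := by
    calc N * Ee ≤ (∑ i, ∑' k, (if ψ i k = 0 then 0 else w k)) * Ee := by gcongr
      _ = ∑ i, (∑' k, (if ψ i k = 0 then 0 else w k)) * Ee := Finset.sum_mul _ _ _
      _ ≤ ∑ i : Fin n, 2 * (1 + N) := Finset.sum_le_sum fun i _ => hi i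
      _ = _ := by simp
  have h2 : N * (1 / ε) ≤ 1 := by
    rw [hEe] at h1
    have : (2 * n) * (N * (1 + 1 / ε)) ≤ (2 * n) * (1 + N) := by linarith
    have := le_of_mul_le_mul_left this (by positivity)
    linarith
  rw [mul_one_div, div_le_one hε] at h2
  exact h2

/-- The normalized Haar measure on the torus. -/
def torusHaar (n : ℕ) : Measure (UnitAddTorus (Fin n)) :=
  Measure.pi fun _ => AddCircle.haarAddCircle

instance torusHaar_prob (n : ℕ) : IsProbabilityMeasure (torusHaar n) := by
  unfold torusHaar; infer_instance

lemma torus_integrable {n : ℕ} (ν : Measure (UnitAddTorus (Fin n))) [IsFiniteMeasure ν]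
    {F : Type*} [NormedAddCommGroup F]
    {f : UnitAddTorus (Fin n) → F} (hf : Continuous f) : Integrable f ν :=
  hf.integrable_of_hasCompactSupport (HasCompactSupport.of_compactSpace f)

lemma haar_mFourier {n : ℕ} (k : Fin n → ℤ) :
    ∫ x, UnitAddTorus.mFourier k x ∂(torusHaar n) = if k = 0 then 1 else 0 := by
  classical
  unfold torusHaar
  simp only [UnitAddTorus.mFourier, ContinuousMap.coe_mk]
  rw [integral_fintype_prod_eq_prod (f := fun i (y : UnitAddCircle) => (fourier (k i) y : ℂ))]
  split_ifs with h
  · subst h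
    simp
  · have : ∃ i, k i ≠ 0 := by
      by_contra hcon
      push Not at hcon
      exact h (funext hcon)
    obtain ⟨i, hi⟩ := this
    refine Finset.prod_eq_zero (Finset.mem_univ i) ?_
    exact integral_eq_zero_of_add_right_eq_neg (μ := AddCircle.haarAddCircle)
      (fourier_add_half_inv_index hi one_pos)

lemma torus_bound {n : ℕ} (ν : Measure (UnitAddTorus (Fin n))) [IsProbabilityMeasure ν]
    (w : (Fin n → ℤ) → ℝ) (hw : Summable w)
    (hν : ∀ k, ‖∫ x, UnitAddTorus.mFourier k x ∂ν‖ ≤ w k) (ε : ℝ)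
    (hε : ∑' k, (if k = 0 then 0 else w k) ≤ ε) (f : C(UnitAddTorus (Fin n), ℂ)) :
    ‖∫ x, f x ∂ν - ∫ x, f x ∂(torusHaar n)‖ ≤ ε * ‖f‖ := by
  classical
  have hw0 : ∀ k, 0 ≤ w k := fun k => (norm_nonneg _).trans (hν k)
  let w' : (Fin n → ℤ) → ℝ := fun k => if k = 0 then 0 else w k
  have hw'0 : ∀ k, 0 ≤ w' k := by
    intro k
    simp only [w']
    split_ifs
    · exact le_rfl
    · exact hw0 k
  have hw's : Summable w' := by
    refine Summable.of_nonneg_of_le hw'0 (fun k => ?_) hw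
    simp only [w']; split_ifs
    · exact hw0 k
    · exact le_rfl
  let c : (Fin n → ℤ) → ℂ := fun k => if k = 0 then 0 else ∫ x, UnitAddTorus.mFourier k x ∂ν
  have hc : ∀ k, ‖c k‖ ≤ w' k := by
    intro k
    simp only [c, w']
    split_ifs
    · simp
    · exact hν k
  let a : (Fin n → ℤ) → C(UnitAddTorus (Fin n), ℂ) → ℂ :=
    fun k f => ∫ x, UnitAddTorus.mFourier (-k) x * f x ∂(torusHaar n)
  have ha : ∀ k f, ‖a k f‖ ≤ ‖f‖ := by
    intro k f
    have h := norm_integral_le_of_norm_le_const (μ := torusHaar n)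
      (f := fun x => UnitAddTorus.mFourier (-k) x * f x) (C := ‖f‖) (Filter.Eventually.of_forall (by
        intro x

        rw [norm_mul]
        have h1 := (UnitAddTorus.mFourier (-k)).norm_coe_le_norm x
        rw [UnitAddTorus.mFourier_norm] at h1
        have h2 := f.norm_coe_le_norm x
        nlinarith [norm_nonneg (f x)]))
    simpa using h
  let Λ : C(UnitAddTorus (Fin n), ℂ) → ℂ := fun f => ∫ x, f x ∂ν - ∫ x, f x ∂(torusHaar n)
  have hspan : ∀ f ∈ Submodule.span ℂ (Set.range (UnitAddTorus.mFourier (d := Fin n))),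
      HasSum (fun k => c k * a k f) (Λ f) := by
    intro f hf
    induction hf using Submodule.span_induction with
    | mem f hf =>
      obtain ⟨m, rfl⟩ := hf
      have h1 : ∀ k, a k (UnitAddTorus.mFourier m) = if k = m then 1 else 0 := by
        intro k
        simp only [a]
        simp_rw [← UnitAddTorus.mFourier_add]
        rw [haar_mFourier]
        congr 1
        rw [neg_add_eq_zero]
      have h2 : Λ (UnitAddTorus.mFourier m) = c m * a m (UnitAddTorus.mFourier m) := by
        rw [h1]
        simp only [Λ, c]
        rw [haar_mFourier]
        split_ifs with h
        · subst h
          simp [UnitAddTorus.mFourier_zero]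
        · simp
      rw [h2]
      refine hasSum_single m ?_
      intro k hk
      rw [h1, if_neg hk, mul_zero]
    | zero =>
      have : Λ 0 = 0 := by simp [Λ]
      rw [this]
      convert hasSum_zero using 2 with k
      simp [a]
    | add f g _ _ hf hg =>
      have h1 : Λ (f + g) = Λ f + Λ g := by
        simp only [Λ, ContinuousMap.add_apply]
        rw [integral_add (torus_integrable _ f.continuous) (torus_integrable _ g.continuous),
          integral_add (torus_integrable _ f.continuous) (torus_integrable _ g.continuous)]
        ring
      rw [h1]
      have h2 : (fun k => c k * a k (f + g)) = fun k => c k * a k f + c k * a k g := by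
        funext k
        simp only [a, ContinuousMap.add_apply, mul_add]
        rw [integral_add (torus_integrable _ (by fun_prop)) (torus_integrable _ (by fun_prop))]
        ring
      rw [h2]
      exact hf.add hg
    | smul r f _ hf =>
      have h1 : Λ (r • f) = r * Λ f := by
        simp only [Λ, ContinuousMap.smul_apply, smul_eq_mul]
        rw [integral_const_mul, integral_const_mul]
        ring
      rw [h1]
      have h2 : (fun k => c k * a k (r • f)) = fun k => r * (c k * a k f) := by
        funext k
        simp only [a, ContinuousMap.smul_apply, smul_eq_mul]
        simp_rw [mul_left_comm _ r]
        rw [integral_const_mul]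
        ring
      rw [h2]
      exact hf.mul_left r
  have hspan2 : ∀ f ∈ Submodule.span ℂ (Set.range (UnitAddTorus.mFourier (d := Fin n))),
      ‖Λ f‖ ≤ ε * ‖f‖ := by
    intro f hf
    have h1 := hspan f hf
    rw [← h1.tsum_eq]
    have h2 : ∀ k, ‖c k * a k f‖ ≤ w' k * ‖f‖ := by
      intro k
      rw [norm_mul]
      exact mul_le_mul (hc k) (ha k f) (norm_nonneg _) (hw'0 k)
    refine (tsum_of_norm_bounded (hw's.mul_right ‖f‖).hasSum h2).trans ?_
    rw [tsum_mul_right]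
    gcongr
  have hΛc : Continuous Λ := by
    have hcont : ∀ (m : Measure (UnitAddTorus (Fin n))) [IsProbabilityMeasure m],
        Continuous fun f : C(UnitAddTorus (Fin n), ℂ) => ∫ x, f x ∂m := by
      intro m _
      refine continuous_iff_continuousAt.2 fun f₀ => ?_
      refine tendsto_iff_norm_sub_tendsto_zero.2 ?_
      have h0 : Filter.Tendsto (fun f : C(UnitAddTorus (Fin n), ℂ) => ‖f - f₀‖) (nhds f₀) (nhds 0) :=
        tendsto_iff_norm_sub_tendsto_zero.1 Filter.tendsto_id
      refine squeeze_zero (fun _ => norm_nonneg _) (fun f => ?_) h0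
      rw [← integral_sub (torus_integrable _ f.continuous) (torus_integrable _ f₀.continuous)]
      have h := norm_integral_le_of_norm_le_const (μ := m) (f := fun x => f x - f₀ x)
        (C := ‖f - f₀‖) (Filter.Eventually.of_forall fun x => (f - f₀).norm_coe_le_norm x)
      simpa using h
    exact (hcont ν).sub (hcont (torusHaar n))
  have hclosed : IsClosed {f : C(UnitAddTorus (Fin n), ℂ) | ‖Λ f‖ ≤ ε * ‖f‖} :=
    isClosed_le hΛc.norm (continuous_const.mul continuous_norm)
  have hmem : f ∈ (Submodule.span ℂ (Set.range (UnitAddTorus.mFourier (d := Fin n)))).topologicalClosure := by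
    rw [UnitAddTorus.span_mFourier_closure_eq_top]; trivial
  exact closure_minimal (fun g hg => hspan2 g hg) hclosed hmem

lemma torus_tv {n : ℕ} (ν : Measure (UnitAddTorus (Fin n))) [IsProbabilityMeasure ν] (ε : ℝ)
    (hb : ∀ f : C(UnitAddTorus (Fin n), ℂ),
      ‖∫ x, f x ∂ν - ∫ x, f x ∂(torusHaar n)‖ ≤ ε * ‖f‖) (hε : 0 ≤ ε)
    (A : Set (UnitAddTorus (Fin n))) (hA : MeasurableSet A) :
    |ν.real A - (torusHaar n).real A| ≤ ε / 2 := by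
  have hreal : ∀ f : UnitAddTorus (Fin n) → ℝ, Continuous f → (∀ x, 0 ≤ f x) → (∀ x, f x ≤ 1) →
      |∫ x, f x ∂ν - ∫ x, f x ∂(torusHaar n)| ≤ ε / 2 := by
    intro f hf h0 h1
    let g : C(UnitAddTorus (Fin n), ℂ) := ⟨fun x => ((f x - 1 / 2 : ℝ) : ℂ), by fun_prop⟩
    have hg : ‖g‖ ≤ 1 / 2 := by
      refine (ContinuousMap.norm_le _ (by norm_num)).2 fun x => ?_
      simp only [g, ContinuousMap.coe_mk]
      rw [Complex.norm_real, Real.norm_eq_abs, abs_le]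
      constructor <;> linarith [h0 x, h1 x]
    have h := hb g
    have hi : ∀ (m : Measure (UnitAddTorus (Fin n))) [IsProbabilityMeasure m],
        ∫ x, g x ∂m = ((∫ x, f x ∂m - 1 / 2 : ℝ) : ℂ) := by
      intro m _
      simp only [g, ContinuousMap.coe_mk]
      rw [integral_complex_ofReal, integral_sub (torus_integrable _ hf) (integrable_const _)]
      simp
    rw [hi, hi, ← Complex.ofReal_sub, Complex.norm_real, Real.norm_eq_abs] at h
    calc _ = |∫ x, f x ∂ν - 1 / 2 - (∫ x, f x ∂(torusHaar n) - 1 / 2)| := by congr 1; ring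
      _ ≤ ε * ‖g‖ := h
      _ ≤ ε * (1 / 2) := by gcongr
      _ = _ := by ring
  have hcl : ∀ K : Set (UnitAddTorus (Fin n)), IsClosed K →
      |ν.real K - (torusHaar n).real K| ≤ ε / 2 := by
    intro K hK
    have hδ : ∀ m : ℕ, (0 : ℝ) < 1 / ((m : ℝ) + 1) := fun m => Nat.one_div_pos_of_nat
    have hlim := tendsto_one_div_add_atTop_nhds_zero_nat (𝕜 := ℝ)
    have t1 := tendsto_integral_thickenedIndicator_of_isClosed ν hK hδ hlim
    have t2 := tendsto_integral_thickenedIndicator_of_isClosed (torusHaar n) hK hδ hlim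
    refine le_of_tendsto (t1.sub t2).abs (Filter.Eventually.of_forall fun m => ?_)
    refine hreal _ (by fun_prop) (fun x => NNReal.coe_nonneg _) (fun x => ?_)
    exact_mod_cast thickenedIndicator_le_one (hδ m) K x
  refine le_of_forall_pos_le_add fun δ hδ => ?_
  obtain ⟨K, hKA, hK, hlt⟩ := hA.exists_isClosed_sdiff_lt (μ := ν + torusHaar n)
    (measure_ne_top _ _) (ε := ENNReal.ofReal δ) (by simpa using hδ)
  have hd : (ν + torusHaar n).real (A \ K) ≤ δ := by
    rw [measureReal_def]
    exact ENNReal.toReal_le_of_le_ofReal hδ.le hlt.le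
  rw [measureReal_add_apply] at hd
  have e1 : ν.real A = ν.real K + ν.real (A \ K) := by
    rw [measureReal_sdiff hKA hK.measurableSet]; ring
  have e2 : (torusHaar n).real A = (torusHaar n).real K + (torusHaar n).real (A \ K) := by
    rw [measureReal_sdiff hKA hK.measurableSet]; ring
  have p1 : 0 ≤ ν.real (A \ K) := measureReal_nonneg
  have p2 : 0 ≤ (torusHaar n).real (A \ K) := measureReal_nonneg
  have := abs_le.1 (hcl K hK)
  rw [abs_le, e1, e2]
  constructor <;> linarith [this.1, this.2]

/-- The covering map followed by a linear map. -/
def latTorusMap {n : ℕ} (M : Matrix (Fin n) (Fin n) ℝ) (x : Fin n → ℝ) : UnitAddTorus (Fin n) :=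
  fun i => ((M.mulVec x i : ℝ) : UnitAddCircle)

lemma latTorusMap_measurable {n : ℕ} (M : Matrix (Fin n) (Fin n) ℝ) : Measurable (latTorusMap M) := by
  apply Continuous.measurable
  unfold latTorusMap
  refine continuous_pi fun i => ?_
  refine (AddCircle.continuous_mk' 1).comp ?_
  exact (continuous_apply i).comp (Continuous.matrix_mulVec continuous_const continuous_id)

lemma torus_char {n : ℕ} (M : Matrix (Fin n) (Fin n) ℝ) (μ : Fin n → ℝ) (v : NNReal)
    (k : Fin n → ℤ) :
    ‖∫ x, UnitAddTorus.mFourier k x ∂((Measure.pi fun i => gaussianReal (μ i) v).map (latTorusMap M))‖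
      = Real.exp (-(2 * π ^ 2 * v) * ∑ j, (∑ i, (k i : ℝ) * M i j) ^ 2) := by
  rw [integral_map (latTorusMap_measurable M).aemeasurable
    (UnitAddTorus.mFourier k).continuous.aestronglyMeasurable]
  let t : Fin n → ℝ := fun j => 2 * π * ∑ i, (k i : ℝ) * M i j
  have h1 : ∀ x, UnitAddTorus.mFourier k (latTorusMap M x) = ∏ j, Complex.exp (t j * x j * Complex.I) := by
    intro x
    simp only [UnitAddTorus.mFourier, ContinuousMap.coe_mk, latTorusMap]
    simp_rw [fourier_coe_apply]
    rw [← Complex.exp_sum, ← Complex.exp_sum]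
    congr 1
    simp only [t, Matrix.mulVec, dotProduct]
    push_cast
    simp_rw [Finset.mul_sum, Finset.sum_mul, Finset.sum_div]
    rw [Finset.sum_comm]
    refine Finset.sum_congr rfl fun j _ => Finset.sum_congr rfl fun i _ => ?_
    ring
  simp_rw [h1]
  rw [integral_fintype_prod_eq_prod (f := fun j (y : ℝ) => Complex.exp (t j * y * Complex.I))]
  simp_rw [← charFun_apply_real, charFun_gaussianReal]
  rw [norm_prod]
  simp_rw [Complex.norm_exp]
  rw [← Real.exp_sum]
  congr 1
  rw [Finset.mul_sum]
  refine Finset.sum_congr rfl fun j _ => ?_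
  have : ((t j : ℂ) * (μ j : ℂ) * Complex.I - (v : ℂ) * (t j : ℂ) ^ 2 / 2).re = - (v * t j ^ 2 / 2) := by
    have h : ((t j : ℂ) * (μ j : ℂ) * Complex.I - (v : ℂ) * (t j : ℂ) ^ 2 / 2)
      = ((t j * μ j : ℝ) : ℂ) * Complex.I + ((-(v * t j ^ 2 / 2) : ℝ) : ℂ) := by push_cast; ring
    rw [h, Complex.add_re, Complex.re_ofReal_mul, Complex.I_re, Complex.ofReal_re]
    simp
  rw [this]
  simp only [t]
  ring

section MatrixPart

open scoped Matrix

lemma enorm2_eq {n : ℕ} (x : Fin n → ℝ) : enorm2 x = ‖(WithLp.toLp 2 x : EuclideanSpace ℝ (Fin n))‖ := by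
  rw [EuclideanSpace.norm_eq]
  simp [enorm2]

/-- The invertible linear map given by the inverse transpose of `B`. -/
def dualMap {n : ℕ} (B : Matrix (Fin n) (Fin n) ℝ) (hB : IsUnit B.det) :
    EuclideanSpace ℝ (Fin n) ≃L[ℝ] EuclideanSpace ℝ (Fin n) :=
  LinearEquiv.toContinuousLinearEquiv
    { toFun := fun x => WithLp.toLp 2 ((B⁻¹)ᵀ.mulVec (WithLp.ofLp x))
      invFun := fun x => WithLp.toLp 2 (Bᵀ.mulVec (WithLp.ofLp x))
      map_add' := fun x y => by simp [Matrix.mulVec_add]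
      map_smul' := fun r x => by simp [Matrix.mulVec_smul]
      left_inv := fun x => by
        simp only [Matrix.mulVec_mulVec]
        rw [← Matrix.transpose_mul, Matrix.nonsing_inv_mul B hB]
        simp
      right_inv := fun x => by
        simp only [Matrix.mulVec_mulVec]
        rw [← Matrix.transpose_mul, Matrix.mul_nonsing_inv B hB]
        simp }

lemma dualMap_apply {n : ℕ} (B : Matrix (Fin n) (Fin n) ℝ) (hB : IsUnit B.det)
    (x : EuclideanSpace ℝ (Fin n)) :
    dualMap B hB x = WithLp.toLp 2 ((B⁻¹)ᵀ.mulVec (WithLp.ofLp x)) := rfl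

lemma dualMap_norm {n : ℕ} (B : Matrix (Fin n) (Fin n) ℝ) (hB : IsUnit B.det) (k : Fin n → ℤ) :
    ‖dualMap B hB (castZ n k)‖ ^ 2 = ∑ j, (∑ i, (k i : ℝ) * B⁻¹ i j) ^ 2 := by
  rw [dualMap_apply, EuclideanSpace.norm_sq_eq]
  refine Finset.sum_congr rfl fun j _ => ?_
  rw [Real.norm_eq_abs, sq_abs]
  simp only [Matrix.mulVec, dotProduct, Matrix.transpose_apply, castZ_apply]
  congr 1
  exact Finset.sum_congr rfl fun i _ => mul_comm _ _

lemma dualMap_dot {n : ℕ} (B : Matrix (Fin n) (Fin n) ℝ) (hB : IsUnit B.det)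
    (x y : Fin n → ℝ) :
    (B⁻¹)ᵀ.mulVec x ⬝ᵥ B.mulVec y = x ⬝ᵥ y := by
  rw [Matrix.mulVec_transpose, ← Matrix.dotProduct_mulVec, Matrix.mulVec_mulVec,
    Matrix.nonsing_inv_mul B hB, Matrix.one_mulVec]

/-- Integer pairing. -/
def intPair {n : ℕ} (a : Fin n → ℤ) : (Fin n → ℤ) →+ ℤ where
  toFun k := k ⬝ᵥ a
  map_zero' := by simp
  map_add' x y := by simp [add_dotProduct]

lemma dualMap_inner {n : ℕ} (B : Matrix (Fin n) (Fin n) ℝ) (hB : IsUnit B.det)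
    (k a : Fin n → ℤ) :
    inner ℝ (dualMap B hB (castZ n k)) (WithLp.toLp 2 (B.mulVec fun i => (a i : ℝ)))
      = ((intPair a k : ℤ) : ℝ) := by
  have h := dualMap_dot B hB (fun i => (k i : ℝ)) (fun i => (a i : ℝ))
  rw [dualMap_apply, EuclideanSpace.inner_toLp_toLp, star_trivial, dotProduct_comm]
  refine h.trans ?_
  simp [intPair, dotProduct]

lemma lambdaN_set_nonempty {n : ℕ} (B : Matrix (Fin n) (Fin n) ℝ) (hB : IsUnit B.det) :
    {r : ℝ | ∃ v : Fin n → (Fin n → ℝ),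
    LinearIndependent ℝ v ∧ ∀ i, v i ∈ latticeSet B ∧ enorm2 (v i) ≤ r}.Nonempty := by
  classical
  refine ⟨∑ i, enorm2 (B.col i), B.col, ?_, fun i => ⟨⟨Pi.single i 1, ?_⟩, ?_⟩⟩
  · rw [Matrix.linearIndependent_cols_iff_isUnit, Matrix.isUnit_iff_isUnit_det]
    exact hB
  · have : (fun j => ((Pi.single i (1 : ℤ) : Fin n → ℤ) j : ℝ)) = Pi.single i 1 := by
      funext j
      by_cases h : j = i
      · subst h; simp
      · simp [h]
    rw [this]
    simp
  · exact Finset.single_le_sum (f := fun i => enorm2 (B.col i))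
      (fun i _ => Real.sqrt_nonneg _) (Finset.mem_univ i)

lemma lambdaN_pos {n : ℕ} (hn : 0 < n) (B : Matrix (Fin n) (Fin n) ℝ) (hB : IsUnit B.det) :
    0 < lambdaN B := by
  classical
  set C : ℝ := ∑ i, enorm2 (B⁻¹ i) + 1 with hC
  have hCpos : 0 < C := by
    have : 0 ≤ ∑ i, enorm2 (B⁻¹ i) := Finset.sum_nonneg fun i _ => Real.sqrt_nonneg _
    linarith
  refine lt_of_lt_of_le (one_div_pos.2 hCpos) ?_
  refine le_csInf (lambdaN_set_nonempty B hB) ?_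
  rintro r ⟨v, hli, hv⟩
  obtain ⟨⟨a, ha⟩, hr⟩ := hv ⟨0, hn⟩
  have hne := hli.ne_zero ⟨0, hn⟩
  have ha0 : ∃ i, a i ≠ 0 := by
    by_contra hcon
    push Not at hcon
    apply hne
    rw [ha]
    simp only [hcon, Int.cast_zero]
    exact Matrix.mulVec_zero B
  obtain ⟨i, hi⟩ := ha0
  have h1 : (a i : ℝ) = B⁻¹ i ⬝ᵥ v ⟨0, hn⟩ := by
    have : (B⁻¹).mulVec (v ⟨0, hn⟩) = fun i => (a i : ℝ) := by
      rw [ha, Matrix.mulVec_mulVec, Matrix.nonsing_inv_mul B hB, Matrix.one_mulVec]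
    exact (congrFun this i).symm
  have h2 : (1 : ℝ) ≤ |(a i : ℝ)| := by exact_mod_cast Int.one_le_abs hi
  have h3 : |B⁻¹ i ⬝ᵥ v ⟨0, hn⟩| ≤ enorm2 (B⁻¹ i) * enorm2 (v ⟨0, hn⟩) := by
    rw [enorm2_eq, enorm2_eq, mul_comm]
    have := abs_real_inner_le_norm (WithLp.toLp 2 (v ⟨0, hn⟩) : EuclideanSpace ℝ (Fin n))
      (WithLp.toLp 2 (B⁻¹ i))
    rwa [EuclideanSpace.inner_toLp_toLp, star_trivial] at this
  have h4 : enorm2 (B⁻¹ i) ≤ C := by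
    have := Finset.single_le_sum (f := fun i => enorm2 (B⁻¹ i))
      (fun i _ => Real.sqrt_nonneg _) (Finset.mem_univ i)
    linarith
  rw [div_le_iff₀ hCpos]
  have h5 : 0 ≤ enorm2 (v ⟨0, hn⟩) := Real.sqrt_nonneg _
  rw [← h1] at h3
  calc (1 : ℝ) ≤ enorm2 (B⁻¹ i) * enorm2 (v ⟨0, hn⟩) := h2.trans h3
    _ ≤ C * r := mul_le_mul h4 hr h5 hCpos.le
    _ = r * C := mul_comm _ _

/-- Lift the torus to the fundamental parallelepiped. -/
def liftP {n : ℕ} (B : Matrix (Fin n) (Fin n) ℝ) (y : UnitAddTorus (Fin n)) : Fin n → ℝ :=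
  B.mulVec fun i => ((AddCircle.measurableEquivIco 1 0 (y i) : Set.Ico (0 : ℝ) (0 + 1)) : ℝ)

lemma mulVec_measurable {n : ℕ} (B : Matrix (Fin n) (Fin n) ℝ) : Measurable B.mulVec :=
  (Continuous.matrix_mulVec continuous_const continuous_id).measurable

lemma liftP_measurable {n : ℕ} (B : Matrix (Fin n) (Fin n) ℝ) : Measurable (liftP B) := by
  refine (mulVec_measurable B).comp ?_
  refine measurable_pi_lambda _ fun i => ?_
  exact measurable_subtype_coe.comp
    ((AddCircle.measurableEquivIco (T := 1) 0).measurable.comp (measurable_pi_apply i))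

lemma liftP_mk {n : ℕ} (B : Matrix (Fin n) (Fin n) ℝ) (x : Fin n → ℝ) :
    liftP B (fun i => ((x i : ℝ) : UnitAddCircle)) = B.mulVec fun i => Int.fract (x i) := by
  unfold liftP
  congr 1
  funext i
  have := AddCircle.coe_equivIco_mk_apply (p := (1 : ℝ)) (x i)
  rw [div_one, mul_one] at this
  exact this

lemma uniformP_eq {n : ℕ} (B : Matrix (Fin n) (Fin n) ℝ) :
    uniformP B = (torusHaar n).map (liftP B) := by
  have h0 : ∀ i : Fin n, MeasurePreserving ((↑) : ℝ → UnitAddCircle)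
      (volume.restrict (Set.Ico (0 : ℝ) 1)) AddCircle.haarAddCircle := by
    intro _
    have h := AddCircle.measurePreserving_mk 1 0
    rw [AddCircle.volume_eq_smul_haarAddCircle, ENNReal.ofReal_one, one_smul, zero_add] at h
    rwa [restrict_Ico_eq_restrict_Ioc]
  have h1 := measurePreserving_pi _ _ h0
  unfold uniformP torusHaar
  rw [← h1.map_eq, Measure.map_map (liftP_measurable B) h1.measurable]
  refine Measure.map_congr ?_
  rw [← Measure.restrict_pi_pi]
  filter_upwards [ae_restrict_mem (MeasurableSet.univ_pi fun _ => measurableSet_Ico)] with x hx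
  simp only [Function.comp]
  refine Eq.trans ?_ (liftP_mk B x).symm
  congr 1
  funext i
  exact (Int.fract_eq_self.2 (hx i (Set.mem_univ i))).symm

lemma reduceModP_eq {n : ℕ} (B : Matrix (Fin n) (Fin n) ℝ) :
    reduceModP B = liftP B ∘ latTorusMap B⁻¹ := by
  funext x
  exact (liftP_mk B _).symm

lemma aux_main {n : ℕ} (hn : 0 < n) (B : Matrix (Fin n) (Fin n) ℝ) (hB : IsUnit B.det)
    (ε : ℝ) (hε : 0 < ε) (σ : ℝ)
    (hσ : Real.sqrt (Real.log (2 * n * (1 + 1 / ε)) / (2 * π ^ 2)) * lambdaN B ≤ σ) :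
    (Summable fun k : Fin n → ℤ => Real.exp (-(2 * π ^ 2 * σ ^ 2) * ‖dualMap B hB (castZ n k)‖ ^ 2)) ∧
    ∑' k : Fin n → ℤ, (if k = 0 then 0 else
      Real.exp (-(2 * π ^ 2 * σ ^ 2) * ‖dualMap B hB (castZ n k)‖ ^ 2)) ≤ ε := by
  classical
  set Ee : ℝ := 2 * n * (1 + 1 / ε) with hEe
  have hn1 : (1 : ℝ) ≤ n := by exact_mod_cast hn
  have hE2 : 2 < Ee := by
    have : 0 < 1 / ε := by positivity
    rw [hEe]; nlinarith
  have hlam := lambdaN_pos hn B hB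
  have hL1 : 0 < Real.log (Ee - 1) := Real.log_pos (by linarith)
  have hL : Real.log (Ee - 1) < Real.log Ee := Real.log_lt_log (by linarith) (by linarith)
  have hπ := Real.pi_pos
  have hsq : 0 < Real.sqrt (Real.log Ee / (2 * π ^ 2)) := by
    apply Real.sqrt_pos.2
    have : 0 < Real.log Ee := hL1.trans hL
    positivity
  have hσ0 : 0 < σ := lt_of_lt_of_le (mul_pos hsq hlam) hσ
  have hσ2 : lambdaN B ^ 2 * Real.log Ee ≤ 2 * π ^ 2 * σ ^ 2 := by
    have h1 : (Real.sqrt (Real.log Ee / (2 * π ^ 2)) * lambdaN B) ^ 2 ≤ σ ^ 2 :=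
      pow_le_pow_left₀ (mul_pos hsq hlam).le hσ 2
    rw [mul_pow, Real.sq_sqrt (Real.sqrt_pos.1 hsq).le, div_mul_eq_mul_div,
      div_le_iff₀ (by positivity)] at h1
    linarith
  set c : ℝ := 2 * π ^ 2 * σ ^ 2 with hc
  have hcpos : 0 < c := by positivity
  set r := Real.sqrt (c / Real.log (Ee - 1)) with hr
  have hlr : lambdaN B < r := by
    rw [hr, Real.lt_sqrt hlam.le, lt_div_iff₀ hL1]
    have : 0 < lambdaN B ^ 2 := by positivity
    nlinarith
  have hr2 : r ^ 2 = c / Real.log (Ee - 1) := Real.sq_sqrt (by positivity)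
  obtain ⟨r', ⟨v, hli, hv⟩, hr'⟩ := exists_lt_of_csInf_lt (lambdaN_set_nonempty B hB) hlr
  choose hmem hnorm using hv
  choose a ha using hmem
  refine aux_smoothing hn (dualMap B hB) c hcpos (fun i => WithLp.toLp 2 (v i)) ?_
    (fun i => intPair (a i)) ?_ ?_ ε hε ?_
  · intro i h
    apply hli.ne_zero i
    have := congrArg WithLp.ofLp h
    simpa using this
  · intro i k
    simp only
    rw [ha i]
    exact dualMap_inner B hB k (a i)
  · intro k hk
    set u : Fin n → ℝ := (B⁻¹)ᵀ.mulVec fun i => (k i : ℝ) with hu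
    have hui : ∀ i, u ⬝ᵥ v i = 0 := by
      intro i
      rw [ha i, hu, dualMap_dot B hB]
      have : ((intPair (a i) k : ℤ) : ℝ) = 0 := by rw [hk i]; simp
      simpa [intPair, dotProduct] using this
    have hspan := hli.span_eq_top_of_card_eq_finrank' (by simp)
    have hall : ∀ y : Fin n → ℝ, u ⬝ᵥ y = 0 := by
      intro y
      have hy : y ∈ Submodule.span ℝ (Set.range v) := by rw [hspan]; trivial
      induction hy using Submodule.span_induction with
      | mem y hy => obtain ⟨i, rfl⟩ := hy; exact hui i
      | zero => simp
      | add x y _ _ hx hy => rw [dotProduct_add, hx, hy, add_zero]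
      | smul t x _ hx => rw [dotProduct_smul, hx, smul_zero]
    funext i
    have h1 := hall (B.mulVec (Pi.single i 1))
    rw [hu, dualMap_dot B hB] at h1
    simpa using h1
  · intro i
    have h1 : ‖(WithLp.toLp 2 (v i) : EuclideanSpace ℝ (Fin n))‖ ≤ r := by
      rw [← enorm2_eq]
      exact (hnorm i).trans hr'.le
    have h0 : 0 < ‖(WithLp.toLp 2 (v i) : EuclideanSpace ℝ (Fin n))‖ := by
      apply norm_pos_iff.2
      intro h
      apply hli.ne_zero i
      have := congrArg WithLp.ofLp h
      simpa using this
    have h2 : Real.log (Ee - 1) ≤ c / ‖(WithLp.toLp 2 (v i) : EuclideanSpace ℝ (Fin n))‖ ^ 2 := by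
      rw [le_div_iff₀ (by positivity)]
      calc _ ≤ Real.log (Ee - 1) * r ^ 2 := by gcongr
        _ = c := by rw [hr2]; field_simp
    have h3 := Real.exp_le_exp.2 h2
    rw [Real.exp_log (by linarith)] at h3
    linarith

end MatrixPart

/-- If `σ ≥ √(ln(2n(1+1/ε))/(2π²)) · λ_n(L(B))`, then `N(μ, σ² I_n) mod P(B)` is within
total variation distance `ε/2` of the uniform distribution on `P(B)`. -/
theorem stmt11 (n : ℕ) (B : Matrix (Fin n) (Fin n) ℝ) (hB : IsUnit B.det)
    (ε : ℝ) (hε : 0 < ε) (σ : ℝ) (μ : Fin n → ℝ)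
    (hσ : Real.sqrt (Real.log (2 * n * (1 + 1 / ε)) / (2 * π ^ 2)) * lambdaN B ≤ σ) :
    ∀ A : Set (Fin n → ℝ), MeasurableSet A →
      |((((Measure.pi fun i : Fin n =>
              gaussianReal (μ i) (Real.toNNReal (σ ^ 2))).map
            (reduceModP B)) A).toReal - ((uniformP B) A).toReal)| ≤ ε / 2 := by
  intro A hA
  rw [uniformP_eq, reduceModP_eq,
    ← Measure.map_map (liftP_measurable B) (latTorusMap_measurable _),
    Measure.map_apply (liftP_measurable B) hA, Measure.map_apply (liftP_measurable B) hA]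
  set ν := (Measure.pi fun i : Fin n =>
    gaussianReal (μ i) (Real.toNNReal (σ ^ 2))).map (latTorusMap B⁻¹) with hν
  have hprob : IsProbabilityMeasure ν :=
    Measure.isProbabilityMeasure_map (latTorusMap_measurable _).aemeasurable
  have hA' : MeasurableSet (liftP B ⁻¹' A) := liftP_measurable B hA
  rcases Nat.eq_zero_or_pos n with hn | hn
  · subst hn
    rcases Subsingleton.set_cases (p := fun S => |(ν S).toReal - (torusHaar 0 S).toReal| ≤ ε / 2)
      (by simp; positivity) (by simp; positivity) (liftP B ⁻¹' A) with h
    exact h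
  · obtain ⟨h1, h2⟩ := aux_main hn B hB ε hε σ hσ
    refine torus_tv ν ε ?_ hε.le _ hA'
    refine torus_bound ν _ h1 (fun k => ?_) ε h2
    rw [hν, torus_char, dualMap_norm, Real.coe_toNNReal _ (sq_nonneg σ)]

end
end
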